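/- Let x ∈ (0,1) be irrational with regular continued fraction convergent denominators (Q_n)_{n≥0}. If Σ_{n=1}^{∞} ( log(Q_{n+1})/√(Q_{n−1}) + Q_{n+1} (log Q_{n+1})² / Q_n^{3/2} ) < ∞, then the series F_1(x) = Σ_{k=1}^{∞} e^{iπk²x}/k converges and F_1(x) = Σ_{j=0}^{∞} e^{(iπ/4) Σ_{ℓ=0}^{j−1} σ(T^ℓ(x))} √(Π_{ℓ=0}^{j−1} |T^ℓ(x)|) · Ω_1(T^j(x)) (empty products equal to 1 for j = 0). Moreover, this summability condition holds for every irrational x ∈ (0,1) whose irrationality exponent satisfies μ(x) < 5/2. -/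

import Mathlib

open Complex Filter Finset

noncomputable section

/-- `ρ = e^{iπ/4}`. -/
def ρ : ℂ := Complex.exp (Real.pi * Complex.I / 4)

/-- Partial sum `F_{s,n}(x,t) = Σ_{k=1}^{n} e^{iπk²x + 2πikt}/k^s`. -/
def Fpart (s : ℝ) (n : ℕ) (x t : ℝ) : ℂ :=
  ∑ k ∈ Finset.Icc 1 n,
    Complex.exp (Real.pi * Complex.I * (k : ℂ) ^ 2 * (x : ℂ)
        + 2 * Real.pi * Complex.I * (k : ℂ) * (t : ℂ)) / (k : ℂ) ^ (s : ℂ)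

/-- The function `I_s(x,t)` (for `x > 0`). -/
def Ifun (s x t : ℝ) : ℂ :=
  (∫ u : ℝ, ρ *
      (Complex.exp (Real.pi * Complex.I * ((1 : ℂ) / 2 + ρ * (u : ℂ)) ^ 2 * (x : ℂ)
            + 2 * Real.pi * Complex.I * ((1 : ℂ) / 2 + ρ * (u : ℂ)) * (Int.fract t : ℝ)) /
        (((1 : ℂ) / 2 + ρ * (u : ℂ)) ^ (s : ℂ) *
          (1 - Complex.exp (2 * Real.pi * Complex.I * ((1 : ℂ) / 2 + ρ * (u : ℂ)))))))
  + ρ * (x : ℂ) ^ (s : ℂ) *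
    ∫ u : ℝ, (Real.exp (-(Real.pi * x * u ^ 2)) : ℝ) *
      ∑' k : ℕ, Complex.exp (-(Real.pi * Complex.I * (((k : ℂ) + 1) - (Int.fract t : ℝ)) ^ 2 / (x : ℂ))) *
        (((ρ * (x : ℂ) * (u : ℂ) + ((k : ℂ) + 1) - (Int.fract t : ℝ)) ^ (s : ℂ))⁻¹
          - (((k : ℂ) + 1) ^ (s : ℂ))⁻¹)

/-- `Ω_s(x,t)`. -/
def Omega (s x t : ℝ) : ℂ :=
  if 0 < x then Ifun s x t else (starRingEnd ℂ) (Ifun s (-x) (-t))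

/-- `Ω_s(x) = Ω_s(x,0)`. -/
def Omega0 (s x : ℝ) : ℂ := Omega s x 0

/-- The map `T(x) = -1/x mod 2`, valued in `(-1,1]`. -/
def Tmap (x : ℝ) : ℝ := -1 / x - 2 * ⌈((-1 / x) - 1) / 2⌉

/-- Denominator `Q_n` of the `n`-th convergent of the regular continued fraction of `x`. -/
def Qden (x : ℝ) (n : ℕ) : ℝ := (GenContFract.of x).dens n

end

open scoped Topology

/-- Irrationality exponent of `x`, as an extended real number. -/
noncomputable def irrExp (x : ℝ) : EReal :=
  sSup {m : EReal | ∃ μ : ℝ, m = (μ : EReal) ∧ 1 ≤ μ ∧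
    {q : ℕ | 1 ≤ q ∧ ∃ p : ℤ, |x - (p : ℝ) / (q : ℝ)| < 1 / (q : ℝ) ^ μ}.Infinite}

open MeasureTheory

theorem not_terminatedAt_of_irrational {x : ℝ} (hx : Irrational x) (n : ℕ) :
    ¬(GenContFract.of x).TerminatedAt n := fun h => by
  obtain ⟨q, hq⟩ := (GenContFract.terminates_iff_rat x).1 ⟨n, h⟩
  exact hx ⟨q, hq.symm⟩

theorem exists_int_contsAux (x : ℝ) (n : ℕ) :
    (∃ P Q : ℤ, (GenContFract.of x).contsAux n = ⟨(P : ℝ), (Q : ℝ)⟩) ∧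
      ∃ P Q : ℤ, (GenContFract.of x).contsAux (n + 1) = ⟨(P : ℝ), (Q : ℝ)⟩ := by
  induction n with
  | zero =>
    refine ⟨⟨1, 0, by simp⟩, ⟨⌊x⌋, 1, ?_⟩⟩
    simp [GenContFract.first_contAux_eq_h_one, GenContFract.of_h_eq_floor]
  | succ n ih =>
    obtain ⟨⟨P, Q, h⟩, ⟨P', Q', h'⟩⟩ := ih
    refine ⟨⟨P', Q', h'⟩, ?_⟩
    rcases hs : (GenContFract.of x).s.get? n with _ | gp
    · refine ⟨P', Q', ?_⟩
      rw [← h']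
      exact GenContFract.contsAux_stable_of_terminated (n + 1).le_succ hs
    · obtain ⟨ha, z, hz⟩ := GenContFract.of_partNum_eq_one_and_exists_int_partDen_eq hs
      refine ⟨z * P' + P, z * Q' + Q, ?_⟩
      rw [GenContFract.contsAux_recurrence hs h h', ha, hz]
      push_cast
      simp

theorem exists_int_nums_dens (x : ℝ) (n : ℕ) :
    ∃ P Q : ℤ, (GenContFract.of x).nums n = P ∧ Qden x n = Q := by
  obtain ⟨P, Q, h⟩ := (exists_int_contsAux x n).2
  refine ⟨P, Q, ?_, ?_⟩
  · rw [GenContFract.num_eq_conts_a, GenContFract.nth_cont_eq_succ_nth_contAux, h]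
  · rw [Qden, GenContFract.den_eq_conts_b, GenContFract.nth_cont_eq_succ_nth_contAux, h]

theorem fib_le_Qden {x : ℝ} (hx : Irrational x) (n : ℕ) : (Nat.fib (n + 1) : ℝ) ≤ Qden x n :=
  GenContFract.succ_nth_fib_le_of_nth_den (Or.inr (not_terminatedAt_of_irrational hx _))

theorem one_le_Qden {x : ℝ} (hx : Irrational x) (n : ℕ) : 1 ≤ Qden x n := by
  refine le_trans ?_ (fib_le_Qden hx n)
  exact_mod_cast Nat.fib_pos.2 n.succ_pos

theorem monotone_Qden (x : ℝ) : Monotone (Qden x) :=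
  monotone_nat_of_le_succ fun _ => GenContFract.of_den_mono

theorem tendsto_Qden {x : ℝ} (hx : Irrational x) : Tendsto (Qden x) atTop atTop := by
  have h : Tendsto (fun n : ℕ => (n : ℝ)) atTop atTop := tendsto_natCast_atTop_atTop
  refine tendsto_atTop_mono' _ ?_ h
  filter_upwards [eventually_ge_atTop 5] with n hn
  refine le_trans ?_ (fib_le_Qden hx n)
  exact_mod_cast (Nat.le_fib_self hn).trans (Nat.fib_mono n.le_succ)

/-- Convergents approximate to within `1 / (Q_n Q_{n+1})`. -/
theorem exists_abs_sub_le_Qden {x : ℝ} (hx : Irrational x) (n : ℕ) :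
    ∃ P Q : ℤ, Qden x n = Q ∧ IsCoprime P Q ∧
      |x - P / Q| ≤ 1 / (Qden x n * Qden x (n + 1)) := by
  obtain ⟨P, Q, hP, hQ⟩ := exists_int_nums_dens x n
  obtain ⟨P', Q', hP', hQ'⟩ := exists_int_nums_dens x (n + 1)
  refine ⟨P, Q, hQ, ?_, ?_⟩
  · have hdet := SimpContFract.determinant (s := SimpContFract.of x) (n := n)
      (not_terminatedAt_of_irrational hx n)
    change (GenContFract.of x).nums n * Qden x (n + 1)
      - Qden x n * (GenContFract.of x).nums (n + 1) = _ at hdet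
    rw [hP, hP', hQ, hQ'] at hdet
    have hdet' : P * Q' - Q * P' = (-1) ^ (n + 1) := by exact_mod_cast hdet
    have hsq : ((-1 : ℤ) ^ (n + 1)) * (-1) ^ (n + 1) = 1 := by
      rw [← pow_add, ← two_mul, pow_mul]; simp
    refine ⟨(-1) ^ (n + 1) * Q', -((-1) ^ (n + 1) * P'), ?_⟩
    calc _ = (-1) ^ (n + 1) * (P * Q' - Q * P') := by ring
      _ = 1 := by rw [hdet', hsq]
  · have := GenContFract.abs_sub_convs_le (v := x) (n := n) (not_terminatedAt_of_irrational hx n)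
    rw [GenContFract.conv_eq_num_div_den, hP] at this
    change |x - P / Qden x n| ≤ _ at this
    rw [hQ] at this
    rw [hQ]
    exact this.trans_eq (by rw [← hQ]; rfl)

/-- A weak form of the law of best approximation. -/
theorem one_div_le_abs_of_two_mul_le_Qden {x : ℝ} (hx : Irrational x) (n : ℕ) {q : ℤ} (p : ℤ)
    (hq : q ≠ 0) (hqn : 2 * |(q : ℝ)| ≤ Qden x n) : 1 / (2 * Qden x n) ≤ |q * x - p| := by
  obtain ⟨P, Q, hQ, hcop, happ⟩ := exists_abs_sub_le_Qden hx n
  have hQ1 := one_le_Qden hx n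
  have hQ2 : Qden x n ≤ Qden x (n + 1) := monotone_Qden x n.le_succ
  rw [hQ] at hqn hQ1 hQ2 happ ⊢
  have hQ0 : (0 : ℝ) < Q := by linarith
  have hne : q * P - p * Q ≠ 0 := by
    intro h
    have hdvd : Q ∣ q := by
      have : Q ∣ P * q := ⟨p, by linarith⟩
      exact hcop.symm.dvd_of_dvd_mul_left this
    have h1 : Q ≤ |q| := Int.le_of_dvd (abs_pos.2 hq) ((dvd_abs _ _).2 hdvd)
    have h2 : (Q : ℝ) ≤ |(q : ℝ)| := by exact_mod_cast h1
    linarith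
  have h1 : (1 : ℝ) ≤ |(q : ℝ) * P - p * Q| := by exact_mod_cast Int.one_le_abs hne
  have h2 : (1 : ℝ) / Q ≤ |q * (P / Q : ℝ) - p| := by
    have : q * (P / Q : ℝ) - p = ((q : ℝ) * P - p * Q) / Q := by field_simp
    rw [this, abs_div, abs_of_pos hQ0]
    gcongr
  have h3 : |(q : ℝ) * (P / Q : ℝ) - q * x| ≤ 1 / (2 * Q) := by
    rw [← mul_sub, abs_mul, abs_sub_comm]
    calc |(q : ℝ)| * |x - P / Q| ≤ (Q / 2) * (1 / (Q * Q)) := by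
          gcongr
          · linarith
          · refine happ.trans ?_
            gcongr
      _ = 1 / (2 * Q) := by field_simp
  have h4 : |q * (P / Q : ℝ) - p| ≤ |(q : ℝ) * (P / Q : ℝ) - q * x| + |q * x - p| :=
    abs_sub_le _ _ _
  have h5 : (1 : ℝ) / Q = 1 / (2 * Q) + 1 / (2 * Q) := by field_simp; norm_num
  linarith

theorem irrational_Tmap {x : ℝ} (hx : Irrational x) : Irrational (Tmap x) := by
  have h : Irrational (-1 / x) := by
    rw [neg_div, one_div]
    exact irrational_neg_iff.2 (irrational_inv_iff.2 hx)
  have := h.sub_intCast (2 * ⌈((-1 / x) - 1) / 2⌉)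
  rw [Tmap]
  exact_mod_cast this

theorem abs_Tmap_lt_one {x : ℝ} (hx : Irrational x) : |Tmap x| < 1 := by
  have h1 := Int.ceil_lt_add_one (((-1 / x) - 1) / 2)
  have h2 := Int.le_ceil (((-1 / x) - 1) / 2)
  have h3 : Tmap x ≠ 1 := (irrational_Tmap hx).ne_one
  rw [abs_lt]
  refine ⟨?_, lt_of_le_of_ne ?_ h3⟩ <;> rw [Tmap] <;> linarith

theorem irrational_iterate_Tmap {x : ℝ} (hx : Irrational x) (j : ℕ) : Irrational (Tmap^[j] x) := by
  induction j with
  | zero => exact hx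
  | succ j ih => rw [Function.iterate_succ_apply']; exact irrational_Tmap ih

theorem abs_iterate_Tmap_lt_one {x : ℝ} (hx : Irrational x) (h1 : |x| < 1) (j : ℕ) :
    |Tmap^[j] x| < 1 := by
  cases j with
  | zero => exact h1
  | succ j =>
    rw [Function.iterate_succ_apply']
    exact abs_Tmap_lt_one (irrational_iterate_Tmap hx j)

/-- Solutions of the recurrence `w_{j+2} = -w_j - 2 b_j w_{j+1}` satisfied by the numerators and
denominators of the even continued fraction with digits `b`. -/
def evenCont (b : ℕ → ℤ) (u v : ℤ) : ℕ → ℤ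
  | 0 => u
  | 1 => v
  | j + 2 => -evenCont b u v j - 2 * b j * evenCont b u v (j + 1)

/-- Denominators and numerators of the even continued fraction expansion of `x`. -/
theorem exists_even_convergents {x : ℝ} (hx : Irrational x) (h1 : |x| < 1) :
    ∃ q p : ℕ → ℤ, (∀ j, |q j| < |q (j + 1)|) ∧
      (∀ j, |q j * x - p j| = ∏ l ∈ range j, |Tmap^[l] x|) ∧
      (∀ j, (q (j + 1) * x - p (j + 1) : ℝ) = Tmap^[j] x * (q j * x - p j)) ∧
      ∀ j, (q j * x - p j) * (q (j + 1) - q j * Tmap^[j] x) = 1 := by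
  set b : ℕ → ℤ := fun j => ⌈((-1 / Tmap^[j] x) - 1) / 2⌉ with hb
  have hT : ∀ j, Tmap^[j + 1] x = -1 / Tmap^[j] x - 2 * b j := fun j => by
    rw [Function.iterate_succ_apply', Tmap]
  have h0 : ∀ j, Tmap^[j] x ≠ 0 := fun j => (irrational_iterate_Tmap hx j).ne_zero
  have hlt := abs_iterate_Tmap_lt_one hx h1
  have hb1 : ∀ j, 1 ≤ |b j| := fun j => by
    refine Int.one_le_abs fun h => ?_
    have h2 := hT j
    rw [h, Int.cast_zero, mul_zero, sub_zero] at h2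
    have h3 := hlt (j + 1)
    rw [h2, abs_div, abs_neg, abs_one, div_lt_one (abs_pos.2 (h0 j))] at h3
    exact absurd (hlt j) (not_lt.2 h3.le)
  set q := evenCont b 0 1 with hq
  set p := evenCont b (-1) 0 with hp
  have hrec : ∀ j, (q (j + 1) * x - p (j + 1) : ℝ) = Tmap^[j] x * (q j * x - p j) := fun j => by
    induction j with
    | zero => simp [hq, hp, evenCont]
    | succ j ih =>
      have e1 : q (j + 1 + 1) = -q j - 2 * b j * q (j + 1) := rfl
      have e2 : p (j + 1 + 1) = -p j - 2 * b j * p (j + 1) := rfl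
      rw [hT, e1, e2]
      push_cast
      have h0' := h0 j
      have : -1 / Tmap^[j] x * (q (j + 1) * x - p (j + 1)) = -(q j * x - p j) := by
        rw [ih]; field_simp
      linear_combination -this
  have hdet : ∀ j, q (j + 1) * p j - q j * p (j + 1) = -1 := fun j => by
    induction j with
    | zero => simp [hq, hp, evenCont]
    | succ j ih =>
      have e1 : q (j + 1 + 1) = -q j - 2 * b j * q (j + 1) := rfl
      have e2 : p (j + 1 + 1) = -p j - 2 * b j * p (j + 1) := rfl
      rw [e1, e2]
      linear_combination ih
  refine ⟨q, p, fun j => ?_, fun j => ?_, hrec, fun j => ?_⟩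
  · induction j with
    | zero => simp [hq, evenCont]
    | succ j ih =>
      have e1 : q (j + 1 + 1) = -q j - 2 * b j * q (j + 1) := rfl
      have h2 : |2 * b j * q (j + 1)| ≤ |q (j + 1 + 1)| + |q j| := by
        have : 2 * b j * q (j + 1) = -q (j + 1 + 1) - q j := by rw [e1]; ring
        rw [this]
        exact (abs_sub _ _).trans_eq (by rw [abs_neg])
      rw [abs_mul, abs_mul, abs_two] at h2
      nlinarith [hb1 j, abs_nonneg (q (j + 1))]
  · induction j with
    | zero => simp [hq, hp, evenCont]
    | succ j ih => rw [hrec, abs_mul, prod_range_succ, ih, mul_comm]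
  · have h2 : (q (j + 1) * p j - q j * p (j + 1) : ℝ) = -1 := by exact_mod_cast hdet j
    have h3 := hrec j
    linear_combination -h2 + q j * h3

theorem summable_of_fiber_sum_le {f G : ℕ → ℝ} (ν : ℕ → ℕ) (hf : ∀ j, 0 ≤ f j) (hG : Summable G)
    (h : ∀ J n, ∑ j ∈ range J with ν j = n, f j ≤ G n) : Summable f := by
  have hG0 : ∀ n, 0 ≤ G n := fun n => by simpa using h 0 n
  refine summable_of_sum_range_le (c := ∑' n, G n) hf fun J => ?_
  rw [← sum_fiberwise_of_maps_to (s := range J) (t := (range J).image ν) (g := ν)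
    (fun j hj => mem_image_of_mem _ hj)]
  exact (sum_le_sum fun n _ => h J n).trans (hG.sum_le_tsum _ fun n _ => hG0 n)

/-- Every sequence value lies between consecutive terms of a sequence tending to infinity. -/
theorem exists_index_between {Q a : ℕ → ℝ} (hQ : Tendsto Q atTop atTop) (ha : ∀ j, Q 0 < a j) :
    ∃ ν : ℕ → ℕ, ∀ j, Q (ν j) < a j ∧ a j ≤ Q (ν j + 1) := by
  have key : ∀ j, ∃ n, Q n < a j ∧ a j ≤ Q (n + 1) := fun j => by
    classical
    have hex : ∃ n, a j ≤ Q n := (hQ.eventually_ge_atTop (a j)).exists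
    obtain ⟨n, hn⟩ : ∃ n, Nat.find hex = n + 1 := Nat.exists_eq_succ_of_ne_zero fun h => by
      have := Nat.find_spec hex
      rw [h] at this
      exact absurd (ha j) (not_lt.2 this)
    refine ⟨n, not_le.1 (Nat.find_min hex (by omega)), hn ▸ Nat.find_spec hex⟩
  exact ⟨fun j => (key j).choose, fun j => (key j).choose_spec⟩

theorem abs_mul_sub_abs_le_one {L u v y : ℝ} (hy : |y| < 1)
    (h : L * (v - u * y) = 1) : |L| * (|v| - |u|) ≤ 1 := by
  have h1 : |L| * |v - u * y| = 1 := by rw [← abs_mul, h, abs_one]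
  have h2 : |v| - |u| ≤ |v - u * y| := by
    have := abs_sub_abs_le_abs_sub v (u * y)
    rw [abs_mul] at this
    nlinarith [abs_nonneg u]
  nlinarith [abs_nonneg L]

theorem abs_mul_abs_le_of_abs_lt {L u v y : ℝ} (huv : |u| < |v|) (hy : |y| < 1 / 4)
    (h : L * (v - u * y) = 1) : |L| * |v| ≤ 4 / 3 := by
  have h1 : |L| * |v - u * y| = 1 := by rw [← abs_mul, h, abs_one]
  have h2 : 3 / 4 * |v| ≤ |v - u * y| := by
    have := abs_sub_abs_le_abs_sub v (u * y)
    rw [abs_mul] at this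
    nlinarith [abs_nonneg u, abs_nonneg y]
  nlinarith [abs_nonneg L]

theorem exists_sign_abs_sub_eq {L y : ℝ} {u v : ℤ} (huv : |u| < |v|) (hy : |y| < 1)
    (h : L * (v - u * y) = 1) :
    ∃ ε : ℤ, |v - ε * u| = |v| - |u| ∧ |(u : ℝ)| * (|L| * |y - ε|) ≤ 1 := by
  have h1 : |L| * |v - u * y| = 1 := by rw [← abs_mul, h, abs_one]
  have hy' := abs_lt.1 hy
  suffices H : ∃ ε : ℤ, |v - ε * u| = |v| - |u| ∧ |(u : ℝ)| * |y - ε| ≤ |v - u * y| by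
    obtain ⟨ε, h2, h3⟩ := H
    refine ⟨ε, h2, ?_⟩
    nlinarith [abs_nonneg L]
  have hc : |(u : ℝ)| < |(v : ℝ)| := by exact_mod_cast huv
  rcases le_total 0 u with hu | hu <;> rcases le_total 0 v with hv | hv
  · refine ⟨1, ?_, ?_⟩
    · rw [abs_of_nonneg hu, abs_of_nonneg hv] at *
      rw [one_mul, abs_of_nonneg]; omega
    · have hu' : (0 : ℝ) ≤ u := by exact_mod_cast hu
      have hv' : (0 : ℝ) ≤ v := by exact_mod_cast hv
      rw [abs_of_nonneg hu', abs_of_nonneg hv'] at hc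
      rw [abs_of_nonneg hu', Int.cast_one, abs_of_nonpos (by linarith)]
      refine le_trans ?_ (le_abs_self _)
      nlinarith
  · refine ⟨-1, ?_, ?_⟩
    · rw [abs_of_nonneg hu, abs_of_nonpos hv] at *
      rw [abs_of_nonpos] <;> omega
    · have hu' : (0 : ℝ) ≤ u := by exact_mod_cast hu
      have hv' : (v : ℝ) ≤ 0 := by exact_mod_cast hv
      rw [abs_of_nonneg hu', abs_of_nonpos hv'] at hc
      push_cast
      rw [abs_of_nonneg hu', abs_of_nonneg (by linarith)]
      refine le_trans ?_ (neg_le_abs _)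
      nlinarith
  · refine ⟨-1, ?_, ?_⟩
    · rw [abs_of_nonpos hu, abs_of_nonneg hv] at *
      rw [abs_of_nonneg] <;> omega
    · have hu' : (u : ℝ) ≤ 0 := by exact_mod_cast hu
      have hv' : (0 : ℝ) ≤ v := by exact_mod_cast hv
      rw [abs_of_nonpos hu', abs_of_nonneg hv'] at hc
      push_cast
      rw [abs_of_nonpos hu', abs_of_nonneg (by linarith)]
      refine le_trans ?_ (le_abs_self _)
      nlinarith
  · refine ⟨1, ?_, ?_⟩
    · rw [abs_of_nonpos hu, abs_of_nonpos hv] at *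
      rw [abs_of_nonpos] <;> omega
    · have hu' : (u : ℝ) ≤ 0 := by exact_mod_cast hu
      have hv' : (v : ℝ) ≤ 0 := by exact_mod_cast hv
      rw [abs_of_nonpos hu', abs_of_nonpos hv'] at hc
      rw [abs_of_nonpos hu', Int.cast_one, abs_of_nonpos (by linarith)]
      refine le_trans ?_ (neg_le_abs _)
      nlinarith

/-- Large denominators of the even continued fraction are spaced by at least half the denominator
of a regular convergent. -/
theorem Qden_lt_two_mul_sub {x : ℝ} (hx : Irrational x) {y : ℝ} (hy : |y| < 1) {q q' p p' : ℤ}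
    (huv : |q| < |q'|) (hstep : (q' * x - p' : ℝ) = y * (q * x - p))
    (hdet : (q * x - p) * (q' - q * y) = 1) {n : ℕ} (hn : 2 * Qden x n < |(q : ℝ)|) :
    Qden x n < 2 * (|(q' : ℝ)| - |(q : ℝ)|) := by
  by_contra! hle
  obtain ⟨ε, h1, h2⟩ := exists_sign_abs_sub_eq huv hy hdet
  have h1' : |(q' : ℝ) - ε * q| = |(q' : ℝ)| - |(q : ℝ)| := by exact_mod_cast h1
  have hQ := one_le_Qden hx n
  have hne : q' - ε * q ≠ 0 := by
    intro h
    rw [h, abs_zero] at h1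
    omega
  have h3 := one_div_le_abs_of_two_mul_le_Qden hx n (p' - ε * p) hne (by push_cast; rwa [h1'])
  have h4 : ((q' - ε * q : ℤ) * x - (p' - ε * p : ℤ) : ℝ) = (q * x - p) * (y - ε) := by
    push_cast
    linear_combination hstep
  rw [h4, abs_mul] at h3
  have h5 : |(q : ℝ)| * (1 / (2 * Qden x n)) ≤ 1 := le_trans (by gcongr) h2
  rw [mul_one_div, div_le_one (by positivity)] at h5
  linarith

theorem card_filter_range_le_of_gap {a : ℕ → ℝ} {d M : ℝ} (hd : 0 < d) (hM0 : 0 ≤ M) (ha0 : ∀ j, 0 ≤ a j)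
    (ha : Monotone a) {S : Finset ℕ} (hM : ∀ j ∈ S, a j ≤ M) (hgap : ∀ j ∈ S, a j + d ≤ a (j + 1)) :
    (#S : ℝ) ≤ M / d + 1 := by
  have hlt : ∀ i ∈ S, ∀ j, i < j → ⌊a i / d⌋₊ < ⌊a j / d⌋₊ := fun i hi j hij => by
    have h1 : a i + d ≤ a j := (hgap i hi).trans (ha hij)
    have h2 : a i / d + 1 ≤ a j / d := by
      rw [← div_self hd.ne', ← add_div]; gcongr
    have h3 := Nat.floor_mono h2
    rw [Nat.floor_add_one (by have := ha0 i; positivity)] at h3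
    omega
  have hinj : Set.InjOn (fun j => ⌊a j / d⌋₊) S := fun i hi j hj hij => by
    rcases lt_trichotomy i j with h | h | h
    · exact absurd hij (hlt i hi j h).ne
    · exact h
    · exact absurd hij (hlt j hj i h).ne'
  have hcard : #S ≤ #(range (⌊M / d⌋₊ + 1)) :=
    card_le_card_of_injOn _ (fun j hj => by
      have : a j / d ≤ M / d := by gcongr; exact hM j hj
      simpa using Nat.lt_succ_of_le (Nat.floor_mono this)) hinj
  rw [card_range] at hcard
  have h4 : (#S : ℝ) ≤ ⌊M / d⌋₊ + 1 := by exact_mod_cast hcard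
  linarith [Nat.floor_le (show 0 ≤ M / d by positivity)]

theorem sqrt_two_div_mul_le {Q R : ℝ} (hQ : 1 ≤ Q) (hR : Q ≤ R) :
    (4 * R / Q + 1) * Real.sqrt (2 / Q) ≤ 10 * (R / Q ^ ((3 : ℝ) / 2)) := by
  have hQ0 : 0 < Q := by linarith
  have h1 : Q ^ ((3 : ℝ) / 2) = Q * Real.sqrt Q := by
    rw [Real.sqrt_eq_rpow, ← Real.rpow_one_add' hQ0.le (by norm_num)]; norm_num
  have h2 : Real.sqrt (2 / Q) ≤ 2 / Real.sqrt Q := by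
    rw [Real.sqrt_div' _ hQ0.le]
    gcongr
    rw [Real.sqrt_le_left] <;> norm_num
  have hs : 0 < Real.sqrt Q := Real.sqrt_pos.2 hQ0
  have h3 : 4 * R / Q + 1 ≤ 5 * R / Q := by
    rw [div_add_one hQ0.ne']; gcongr; linarith
  have hR0 : 0 < R := by linarith
  calc (4 * R / Q + 1) * Real.sqrt (2 / Q) ≤ (5 * R / Q) * (2 / Real.sqrt Q) := by gcongr
    _ = 10 * (R / Q ^ ((3 : ℝ) / 2)) := by rw [h1]; field_simp; norm_num

theorem inv_sqrt_le_div_rpow {Q R : ℝ} (hQ : 1 ≤ Q) (hR : Q ≤ R) :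
    1 / Real.sqrt Q ≤ R / Q ^ ((3 : ℝ) / 2) := by
  have hQ0 : 0 < Q := by linarith
  have h1 : Q ^ ((3 : ℝ) / 2) = Q * Real.sqrt Q := by
    rw [Real.sqrt_eq_rpow, ← Real.rpow_one_add' hQ0.le (by norm_num)]; norm_num
  have hs : 0 < Real.sqrt Q := Real.sqrt_pos.2 hQ0
  rw [h1, div_le_div_iff₀ hs (by positivity)]
  nlinarith

theorem summable_Qden_div {x : ℝ} (hx : Irrational x)
    (h : Summable fun n => Qden x (n + 1) * Real.log (Qden x (n + 1)) ^ 2 /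
      Qden x n ^ ((3 : ℝ) / 2)) :
    (Summable fun n => Qden x (n + 1) / Qden x n ^ ((3 : ℝ) / 2)) ∧
      Summable fun n => Real.log (2 * Qden x (n + 1)) / Real.sqrt (Qden x n) := by
  have hlarge : ∀ᶠ n in atTop, 1 ≤ Real.log (Qden x (n + 1)) :=
    (Real.tendsto_log_atTop.comp ((tendsto_Qden hx).comp (tendsto_add_atTop_nat 1))).eventually_ge_atTop 1
  have hpos : ∀ n, 0 < Qden x n := fun n => lt_of_lt_of_le one_pos (one_le_Qden hx n)
  constructor
  · refine summable_of_isBigO_nat h (Asymptotics.IsBigO.of_bound 1 ?_)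
    filter_upwards [hlarge] with n hn
    have := hpos n
    have h1 := hpos (n + 1)
    rw [one_mul, Real.norm_of_nonneg (by positivity), Real.norm_of_nonneg (by positivity)]
    gcongr
    exact le_mul_of_one_le_right h1.le (one_le_pow₀ hn)
  · refine summable_of_isBigO_nat h (Asymptotics.IsBigO.of_bound 2 ?_)
    filter_upwards [hlarge] with n hn
    have h0 := hpos n
    have h1 := hpos (n + 1)
    have hle := inv_sqrt_le_div_rpow (one_le_Qden hx n) (monotone_Qden x n.le_succ)
    have hlog : Real.log (2 * Qden x (n + 1)) ≤ 2 * Real.log (Qden x (n + 1)) ^ 2 := by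
      rw [Real.log_mul two_ne_zero h1.ne']
      have := Real.log_two_lt_d9
      nlinarith
    have hlog0 : 0 ≤ Real.log (2 * Qden x (n + 1)) :=
      Real.log_nonneg (by linarith [one_le_Qden hx (n + 1)])
    rw [Real.norm_of_nonneg (by positivity), Real.norm_of_nonneg (by positivity)]
    calc Real.log (2 * Qden x (n + 1)) / Real.sqrt (Qden x n)
        = Real.log (2 * Qden x (n + 1)) * (1 / Real.sqrt (Qden x n)) := by ring
      _ ≤ (2 * Real.log (Qden x (n + 1)) ^ 2) * (Qden x (n + 1) / Qden x n ^ ((3 : ℝ) / 2)) := by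
          gcongr
      _ = _ := by ring

/-- The products of iterates of `Tmap` are summable against the logarithmic size of the
functions `Omega0 1`. -/
theorem summable_sqrt_prod_iterate {x : ℝ} (hx : Irrational x) (h1 : |x| < 1)
    (h : Summable fun n => Qden x (n + 1) * Real.log (Qden x (n + 1)) ^ 2 /
      Qden x n ^ ((3 : ℝ) / 2)) :
    (Summable fun j => Real.sqrt (∏ l ∈ range j, |Tmap^[l] x|)) ∧
      Summable fun j => Real.sqrt (∏ l ∈ range j, |Tmap^[l] x|) * -Real.log |Tmap^[j] x| := by
  obtain ⟨q, p, hqlt, hβ, hstep, hdet⟩ := exists_even_convergents hx h1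
  obtain ⟨hS1, hS2⟩ := summable_Qden_div hx h
  have hy := abs_iterate_Tmap_lt_one hx h1
  have hy0 : ∀ j, 0 < |Tmap^[j] x| := fun j => abs_pos.2 (irrational_iterate_Tmap hx j).ne_zero
  set β : ℕ → ℝ := fun j => ∏ l ∈ range j, |Tmap^[l] x| with hβdef
  have hβpos : ∀ j, 0 < β j := fun j => prod_pos fun l _ => hy0 l
  have hβq : ∀ j, |(q j * x - p j : ℝ)| = β j := hβ
  have hqmono : StrictMono fun j => |q j| := strictMono_nat_of_lt_succ hqlt
  have hqge : ∀ j : ℕ, (j : ℤ) ≤ |q j| := fun j => by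
    induction j with
    | zero => simp
    | succ j ih => have := hqlt j; push_cast; omega
  have hqmonoR : Monotone fun j => |(q j : ℝ)| := fun i j hij => by
    have := hqmono.monotone hij
    change |q i| ≤ |q j| at this
    change |(q i : ℝ)| ≤ |(q j : ℝ)|
    exact_mod_cast this
  have hQ1 := one_le_Qden hx
  have hQ0 : ∀ n, 0 < Qden x n := fun n => lt_of_lt_of_le one_pos (hQ1 n)
  have hQzero : Qden x 0 = 1 := by simp [Qden]
  have hsum1 : Summable fun j => Real.sqrt (β j) := by
    rw [← summable_nat_add_iff 3]
    obtain ⟨ν, hν⟩ := exists_index_between (Q := fun n => 2 * Qden x n)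
      (a := fun j => |(q (j + 3) : ℝ)|) ((tendsto_Qden hx).const_mul_atTop two_pos) (fun j => by
        have : ((j + 3 : ℕ) : ℤ) ≤ |q (j + 3)| := hqge (j + 3)
        have : ((j + 3 : ℕ) : ℝ) ≤ |(q (j + 3) : ℝ)| := by exact_mod_cast this
        push_cast at this
        have hj : (0 : ℝ) ≤ j := Nat.cast_nonneg j
        simp only [hQzero]
        linarith)
    refine summable_of_fiber_sum_le ν (fun j => Real.sqrt_nonneg _) (hS1.mul_left 10) fun J n => ?_
    set S := (range J).filter fun j => ν j = n with hS
    have hgap : ∀ j ∈ S, Qden x n < 2 * (|(q (j + 3 + 1) : ℝ)| - |(q (j + 3) : ℝ)|) := fun j hj => by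
      refine Qden_lt_two_mul_sub hx (hy _) (hqlt _) (hstep _) (hdet _) ?_
      have := (hν j).1
      rwa [(mem_filter.1 hj).2] at this
    have hcard : (#S : ℝ) ≤ 2 * Qden x (n + 1) / (Qden x n / 2) + 1 := by
      have := hQ0 n
      have := hQ0 (n + 1)
      refine card_filter_range_le_of_gap (a := fun j => |(q (j + 3) : ℝ)|) (by positivity)
        (by positivity) (fun j => abs_nonneg _)
        (fun i j hij => hqmonoR (by omega)) (fun j hj => ?_) fun j hj => ?_
      · have := (hν j).2
        rwa [(mem_filter.1 hj).2] at this
      · have := hgap j hj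
        have e : j + 1 + 3 = j + 3 + 1 := by omega
        simp only [e]
        linarith
    have hterm : ∀ j ∈ S, Real.sqrt (β (j + 3)) ≤ Real.sqrt (2 / Qden x n) := fun j hj => by
      refine Real.sqrt_le_sqrt ?_
      have h2 := abs_mul_sub_abs_le_one (hy _) (hdet (j + 3))
      rw [hβq] at h2
      have h3 := hgap j hj
      rw [le_div_iff₀ (hQ0 n)]
      nlinarith [hβpos (j + 3)]
    calc ∑ j ∈ S, Real.sqrt (β (j + 3)) ≤ #S • Real.sqrt (2 / Qden x n) := sum_le_card_nsmul _ _ _ hterm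
      _ = #S * Real.sqrt (2 / Qden x n) := nsmul_eq_mul _ _
      _ ≤ (4 * Qden x (n + 1) / Qden x n + 1) * Real.sqrt (2 / Qden x n) := by
          gcongr
          refine hcard.trans_eq ?_
          have := hQ0 n
          field_simp
          ring
      _ ≤ _ := sqrt_two_div_mul_le (hQ1 n) (monotone_Qden x n.le_succ)
  refine ⟨hsum1, ?_⟩
  have hlogpos : ∀ j, 0 ≤ -Real.log |Tmap^[j] x| := fun j =>
    neg_nonneg.2 (Real.log_nonpos (abs_nonneg _) (hy j).le)
  have hsum2 : Summable fun j =>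
      if |Tmap^[j] x| < 1 / 4 then Real.sqrt (β j) * -Real.log |Tmap^[j] x| else 0 := by
    obtain ⟨ν, hν⟩ := exists_index_between (Q := fun n => Qden x n)
      (a := fun j => 2 * |(q (j + 1) : ℝ)|) (tendsto_Qden hx) (fun j => by
        have : ((j + 1 : ℕ) : ℤ) ≤ |q (j + 1)| := hqge (j + 1)
        have : ((j + 1 : ℕ) : ℝ) ≤ |(q (j + 1) : ℝ)| := by exact_mod_cast this
        push_cast at this
        have hj : (0 : ℝ) ≤ j := Nat.cast_nonneg j
        simp only [hQzero]
        linarith)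
    refine summable_of_fiber_sum_le ν (fun j => ?_) (hS2.mul_left 2) fun J n => ?_
    · split_ifs
      · exact mul_nonneg (Real.sqrt_nonneg _) (hlogpos j)
      · exact le_rfl
    set S := (range J).filter fun j => ν j = n with hS
    have hterm : ∀ j ∈ S, (if |Tmap^[j] x| < 1 / 4 then Real.sqrt (β j) * -Real.log |Tmap^[j] x|
        else 0) ≤ 2 / Real.sqrt (Qden x n) * -Real.log |Tmap^[j] x| := fun j hj => by
      split_ifs with hlt
      · refine mul_le_mul_of_nonneg_right ?_ (hlogpos j)
        have h2 := abs_mul_abs_le_of_abs_lt (by exact_mod_cast hqlt j) hlt (hdet j)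
        rw [hβq] at h2
        have h3 := (hν j).1
        rw [(mem_filter.1 hj).2] at h3
        have h4 : β j ≤ 4 / Qden x n := by
          rw [le_div_iff₀ (hQ0 n)]
          nlinarith [hβpos j]
        refine (Real.sqrt_le_sqrt h4).trans_eq ?_
        rw [Real.sqrt_div' _ (hQ0 n).le, show (4 : ℝ) = 2 ^ 2 by norm_num,
          Real.sqrt_sq two_pos.le]
      · exact mul_nonneg (by positivity) (hlogpos j)
    have hlog : ∑ j ∈ S, -Real.log |Tmap^[j] x| ≤ Real.log (2 * Qden x (n + 1)) := by
      rcases S.eq_empty_or_nonempty with he | hne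
      · rw [he, sum_empty]
        exact Real.log_nonneg (by linarith [hQ1 (n + 1)])
      set m := S.max' hne with hm
      have hmS : m ∈ S := S.max'_mem hne
      have hsub : S ⊆ range (m + 1) := fun j hj =>
        mem_range.2 (Nat.lt_succ_of_le (S.le_max' j hj))
      have h2 : ∑ j ∈ range (m + 1), -Real.log |Tmap^[j] x| = -Real.log (β (m + 1)) := by
        rw [hβdef, Real.log_prod (fun l _ => (hy0 l).ne'), sum_neg_distrib]
      have h3 : 1 / (2 * Qden x (n + 1)) ≤ β (m + 1) := by
        rw [← hβq]
        refine one_div_le_abs_of_two_mul_le_Qden hx _ _ ?_ ?_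
        · intro h0
          have := hqge (m + 1)
          rw [h0] at this
          simp at this
          omega
        · have := (hν m).2
          rwa [(mem_filter.1 hmS).2] at this
      refine (sum_le_sum_of_subset_of_nonneg hsub fun j _ _ => hlogpos j).trans ?_
      rw [h2, ← Real.log_inv]
      have := hQ0 (n + 1)
      refine Real.log_le_log (inv_pos.2 (hβpos _)) ?_
      rw [one_div] at h3
      exact inv_le_of_inv_le₀ (by positivity) h3
    calc _ ≤ ∑ j ∈ S, 2 / Real.sqrt (Qden x n) * -Real.log |Tmap^[j] x| := sum_le_sum hterm
      _ = 2 / Real.sqrt (Qden x n) * ∑ j ∈ S, -Real.log |Tmap^[j] x| := by rw [mul_sum]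
      _ ≤ 2 / Real.sqrt (Qden x n) * Real.log (2 * Qden x (n + 1)) := by gcongr
      _ = _ := by ring
  refine Summable.of_nonneg_of_le (fun j => mul_nonneg (Real.sqrt_nonneg _) (hlogpos j)) (fun j => ?_)
    ((hsum1.mul_left (Real.log 4)).add hsum2)
  split_ifs with hlt
  · have : 0 ≤ Real.log 4 * Real.sqrt (β j) :=
      mul_nonneg (Real.log_nonneg (by norm_num)) (Real.sqrt_nonneg _)
    linarith
  · rw [add_zero, mul_comm]
    gcongr
    rw [← Real.log_inv]
    refine Real.log_le_log (inv_pos.2 (hy0 j)) ?_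
    rw [inv_le_comm₀ (hy0 j) (by norm_num)]
    linarith

theorem pow_three_half_le_two_mul_fib (n : ℕ) :
    ((3 : ℝ) / 2) ^ n ≤ 2 * Nat.fib (n + 1) ∧ ((3 : ℝ) / 2) ^ (n + 1) ≤ 2 * Nat.fib (n + 2) := by
  induction n with
  | zero => norm_num
  | succ n ih =>
    refine ⟨ih.2, ?_⟩
    rw [show n + 1 + 2 = n + 1 + 1 + 1 from rfl, Nat.fib_add_two (n := n + 1), pow_succ, pow_succ]
    have h1 := ih.1
    have h2 := ih.2
    rw [pow_succ] at h2
    push_cast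
    have : (0 : ℝ) < (3 / 2) ^ n := by positivity
    rw [show n + 1 + 1 = n + 2 from rfl]
    linarith

theorem summable_Qden_rpow_neg {x : ℝ} (hx : Irrational x) {a : ℝ} (ha : 0 < a) :
    Summable fun n => Qden x n ^ (-a) := by
  have hr : ((3 : ℝ) / 2) ^ (-a) < 1 := Real.rpow_lt_one_of_one_lt_of_neg (by norm_num) (by linarith)
  have hr0 : 0 ≤ ((3 : ℝ) / 2) ^ (-a) := by positivity
  refine Summable.of_nonneg_of_le (fun n => Real.rpow_nonneg (by linarith [one_le_Qden hx n]) _)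
    (fun n => ?_) ((summable_geometric_of_lt_one hr0 hr).mul_left ((2 : ℝ)⁻¹ ^ (-a)))
  have h1 : (2 : ℝ)⁻¹ * (3 / 2) ^ n ≤ Qden x n := by
    have := (pow_three_half_le_two_mul_fib n).1
    linarith [fib_le_Qden hx n]
  calc Qden x n ^ (-a) ≤ ((2 : ℝ)⁻¹ * (3 / 2) ^ n) ^ (-a) :=
        Real.rpow_le_rpow_of_nonpos (by positivity) h1 (by linarith)
    _ = _ := by
        rw [Real.mul_rpow (by positivity) (by positivity), ← Real.rpow_natCast,
          ← Real.rpow_natCast, ← Real.rpow_mul (by norm_num), ← Real.rpow_mul (by norm_num),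
          mul_comm (n : ℝ)]

theorem eventually_Qden_succ_le {x : ℝ} (hx : Irrational x)
    (h : irrExp x < (((5 : ℝ) / 2 : ℝ) : EReal)) :
    ∃ θ : ℝ, 1 ≤ θ ∧ θ < 3 / 2 ∧ ∀ᶠ n in atTop, Qden x (n + 1) ≤ Qden x n ^ θ := by
  obtain ⟨μ', h1, h2⟩ := EReal.lt_iff_exists_real_btwn.1 h
  set μ := max μ' 2 with hμ
  have hμ2 : 2 ≤ μ := le_max_right _ _
  have hμ5 : μ < 5 / 2 := max_lt (by exact_mod_cast h2) (by norm_num)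
  have hfin : ¬{q : ℕ | 1 ≤ q ∧ ∃ p : ℤ, |x - (p : ℝ) / (q : ℝ)| < 1 / (q : ℝ) ^ μ}.Infinite := by
    intro hinf
    have h3 : (μ : EReal) ≤ irrExp x := le_sSup ⟨μ, rfl, by linarith, hinf⟩
    have h4 : (μ' : EReal) ≤ μ := by exact_mod_cast le_max_left _ _
    exact absurd (h1.trans_le h4) (not_lt.2 h3)
  rw [Set.not_infinite] at hfin
  obtain ⟨B, hB⟩ := hfin.bddAbove
  refine ⟨μ - 1, by linarith, by linarith, ?_⟩
  filter_upwards [(tendsto_Qden hx).eventually_gt_atTop (B : ℝ)] with n hn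
  obtain ⟨P, Q, hQ, -, happ⟩ := exists_abs_sub_le_Qden hx n
  have hQ1 := one_le_Qden hx n
  have hR1 := one_le_Qden hx (n + 1)
  rw [hQ] at hn hQ1 happ ⊢
  obtain ⟨m, rfl⟩ : ∃ m : ℕ, Q = m := Int.eq_ofNat_of_zero_le (by
    have : (1 : ℤ) ≤ Q := by exact_mod_cast hQ1
    omega)
  simp only [Int.cast_natCast] at hn hQ1 happ ⊢
  have hmem : m ∉ {q : ℕ | 1 ≤ q ∧ ∃ p : ℤ, |x - (p : ℝ) / (q : ℝ)| < 1 / (q : ℝ) ^ μ} := by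
    intro hm
    have h5 : m ≤ B := hB hm
    have h6 : B < m := by exact_mod_cast hn
    omega
  have h7 : 1 / (m : ℝ) ^ μ ≤ |x - P / m| := by
    by_contra! hlt
    exact hmem ⟨by exact_mod_cast hQ1, P, hlt⟩
  have hm0 : (0 : ℝ) < m := by linarith
  have h8 := h7.trans happ
  rw [one_div_le_one_div (by positivity) (by positivity)] at h8
  rw [Real.rpow_sub_one hm0.ne', le_div_iff₀ hm0]
  linarith

theorem log_sq_mul_rpow_le {Q θ ε : ℝ} (hQ : 1 ≤ Q) (hε : 0 < ε) (hθ : θ = 3 / 2 - ε) :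
    Q ^ θ * Real.log Q ^ 2 / Q ^ ((3 : ℝ) / 2) ≤ (4 / ε) ^ 2 * Q ^ (-(ε / 2)) := by
  have hQ0 : 0 < Q := by linarith
  have h1 : Real.log Q ≤ 4 / ε * Q ^ (ε / 4) := by
    have := Real.log_le_rpow_div hQ0.le (show 0 < ε / 4 by positivity)
    refine this.trans_eq ?_
    field_simp
  have h2 : Real.log Q ^ 2 ≤ (4 / ε) ^ 2 * Q ^ (ε / 2) := by
    calc Real.log Q ^ 2 ≤ (4 / ε * Q ^ (ε / 4)) ^ 2 := by
          have := Real.log_nonneg hQ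
          gcongr
      _ = (4 / ε) ^ 2 * Q ^ (ε / 2) := by
          rw [mul_pow, ← Real.rpow_mul_natCast hQ0.le]
          norm_num
          left; congr 1; ring
  calc Q ^ θ * Real.log Q ^ 2 / Q ^ ((3 : ℝ) / 2)
      ≤ Q ^ θ * ((4 / ε) ^ 2 * Q ^ (ε / 2)) / Q ^ ((3 : ℝ) / 2) := by gcongr
    _ = (4 / ε) ^ 2 * (Q ^ θ * Q ^ (ε / 2) / Q ^ ((3 : ℝ) / 2)) := by ring
    _ = _ := by
        rw [← Real.rpow_add hQ0, ← Real.rpow_sub hQ0]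
        congr 2
        rw [hθ]; ring

theorem summable_of_irrExp_lt {x : ℝ} (hx : Irrational x)
    (h : irrExp x < (((5 : ℝ) / 2 : ℝ) : EReal)) :
    Summable (fun n : ℕ =>
        Real.log (Qden x (n + 2)) / Real.sqrt (Qden x n)
          + Qden x (n + 2) * Real.log (Qden x (n + 2)) ^ 2 / Qden x (n + 1) ^ ((3 : ℝ) / 2)) := by
  obtain ⟨θ, hθ1, hθ2, hθ⟩ := eventually_Qden_succ_le hx h
  have hlog : ∀ n, 0 ≤ Real.log (Qden x n) := fun n => Real.log_nonneg (one_le_Qden hx n)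
  have hpos : ∀ n, 0 < Qden x n := fun n => lt_of_lt_of_le one_pos (one_le_Qden hx n)
  have hθlog : ∀ᶠ n in atTop, Real.log (Qden x (n + 1)) ≤ θ * Real.log (Qden x n) := by
    filter_upwards [hθ] with n hn
    rw [← Real.log_rpow (hpos n)]
    exact Real.log_le_log (hpos _) hn
  have hs : ∀ f : ℕ → ℕ, ∀ a : ℝ, 0 < a → Function.Injective f →
      Summable fun n => Qden x (f n) ^ (-a) := fun f a ha hf =>
    (summable_Qden_rpow_neg hx ha).comp_injective hf
  refine Summable.add ?_ ?_
  · refine summable_of_isBigO_nat (hs id (1 / 4) (by norm_num) Function.injective_id)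
      (Asymptotics.IsBigO.of_bound (θ * θ * 4) ?_)
    filter_upwards [hθlog, (tendsto_add_atTop_nat 1).eventually hθlog] with n h1 h2
    have hQ := hpos n
    have h3 : Real.log (Qden x n) ≤ 4 * Qden x n ^ ((1 : ℝ) / 4) := by
      have := Real.log_le_rpow_div hQ.le (show (0 : ℝ) < 1 / 4 by norm_num)
      linarith
    have hl := hlog (n + 2)
    rw [Real.norm_of_nonneg (by positivity), Real.norm_of_nonneg (by positivity),
      Real.sqrt_eq_rpow, div_le_iff₀ (by positivity), mul_assoc, id, ← Real.rpow_add hQ]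
    have h4 : Real.log (Qden x (n + 2)) ≤ θ * (θ * (4 * Qden x n ^ ((1 : ℝ) / 4))) :=
      h2.trans (by gcongr; exact h1.trans (by gcongr))
    refine h4.trans_eq ?_
    norm_num
    ring
  · refine summable_of_isBigO_nat (hs (fun n => n + 1) ((3 / 2 - θ) / 2) (by linarith)
      (add_left_injective 1)) (Asymptotics.IsBigO.of_bound (θ ^ 2 * (4 / (3 / 2 - θ)) ^ 2) ?_)
    filter_upwards [(tendsto_add_atTop_nat 1).eventually hθ,
      (tendsto_add_atTop_nat 1).eventually hθlog] with n h1 h2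
    have hQ := hpos (n + 1)
    have hQ2 := hpos (n + 2)
    have hl := hlog (n + 2)
    rw [Real.norm_of_nonneg (by positivity), Real.norm_of_nonneg (by positivity)]
    calc Qden x (n + 2) * Real.log (Qden x (n + 2)) ^ 2 / Qden x (n + 1) ^ ((3 : ℝ) / 2)
        ≤ Qden x (n + 1) ^ θ * (θ * Real.log (Qden x (n + 1))) ^ 2
          / Qden x (n + 1) ^ ((3 : ℝ) / 2) := by gcongr
      _ = θ ^ 2 * (Qden x (n + 1) ^ θ * Real.log (Qden x (n + 1)) ^ 2
          / Qden x (n + 1) ^ ((3 : ℝ) / 2)) := by ring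
      _ ≤ θ ^ 2 * ((4 / (3 / 2 - θ)) ^ 2 * Qden x (n + 1) ^ (-((3 / 2 - θ) / 2))) := by
          gcongr
          exact log_sq_mul_rpow_le (one_le_Qden hx _) (by linarith) (by ring)
      _ = _ := by ring

theorem rho_eq : ρ = ((1 + I) / Real.sqrt 2 : ℂ) := by
  have h : (Real.sqrt 2 : ℂ) ^ 2 = 2 := by
    rw [← ofReal_pow, Real.sq_sqrt two_pos.le]; simp
  have h0 : (Real.sqrt 2 : ℂ) ≠ 0 := fun h0 => by rw [h0] at h; norm_num at h
  rw [ρ, show (Real.pi * I / 4 : ℂ) = ((Real.pi / 4 : ℝ) : ℂ) * I by push_cast; ring, exp_mul_I,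
    ← ofReal_cos, ← ofReal_sin, Real.cos_pi_div_four, Real.sin_pi_div_four, eq_div_iff h0]
  push_cast
  linear_combination (1 / 2 + I / 2) * h

theorem norm_rho : ‖ρ‖ = 1 := by
  rw [ρ, show (Real.pi * I / 4 : ℂ) = ((Real.pi / 4 : ℝ) : ℂ) * I by push_cast; ring,
    norm_exp_ofReal_mul_I]

theorem rho_sq : ρ ^ 2 = I := by
  rw [ρ, ← exp_nat_mul, show ((2 : ℕ) * (Real.pi * I / 4) : ℂ) = Real.pi / 2 * I by push_cast; ring,
    exp_pi_div_two_mul_I]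

theorem rho_ne_zero : ρ ≠ 0 := exp_ne_zero _

theorem rho_re : ρ.re = 1 / Real.sqrt 2 := by
  rw [rho_eq, div_ofReal_re]; simp

theorem rho_im : ρ.im = 1 / Real.sqrt 2 := by
  rw [rho_eq, div_ofReal_im]; simp

theorem line_re (c u : ℝ) : (c + ρ * u : ℂ).re = c + u / Real.sqrt 2 := by
  rw [add_re, re_mul_ofReal, rho_re, ofReal_re]; ring

theorem line_im (c u : ℝ) : (c + ρ * u : ℂ).im = u / Real.sqrt 2 := by
  rw [add_im, im_mul_ofReal, rho_im, ofReal_im]; ring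

/-- Rotated Cartesian coordinates for the oblique lines `c + ρ ℝ`. -/
theorem rho_mul_add_mul_I (t y : ℝ) :
    ρ * (t + y * I) = ((-(Real.sqrt 2 * y) : ℝ) : ℂ) + ρ * ((t + y : ℝ) : ℂ) := by
  have hs : Real.sqrt 2 * Real.sqrt 2 = 2 := Real.mul_self_sqrt two_pos.le
  have h0 : Real.sqrt 2 ≠ 0 := by positivity
  apply Complex.ext
  · rw [line_re, mul_re, rho_re, rho_im]
    simp
    field_simp
    rw [Real.sq_sqrt two_pos.le]
    ring
  · rw [line_im, mul_im, rho_re, rho_im]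
    simp
    field_simp
    ring

theorem integral_eq_zero_of_tendsto {d : ℝ → ℂ} (hd : Integrable d)
    (h : Tendsto (fun T : ℝ => ∫ t in -T..T, d t) atTop (𝓝 0)) : ∫ t, d t = 0 :=
  tendsto_nhds_unique
    (intervalIntegral_tendsto_integral hd tendsto_neg_atTop_atBot tendsto_id) h

/-- Cauchy's theorem for an oblique strip: the integrals over two boundary lines agree. -/
theorem integral_sub_eq_zero_of_strip {f : ℂ → ℂ} {c₁ c₂ : ℝ}
    (hf : DifferentiableOn ℂ f {z | z.re - z.im ∈ Set.Icc c₁ c₂})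
    (hdecay : ∀ ε > 0, ∃ U : ℝ, ∀ c ∈ Set.Icc c₁ c₂, ∀ u : ℝ, U ≤ |u| → ‖f (c + ρ * u)‖ ≤ ε)
    (hc : c₁ ≤ c₂)
    (hd : Integrable fun t : ℝ => f (c₂ + ρ * ((t - c₂ / Real.sqrt 2 : ℝ) : ℂ)) -
      f (c₁ + ρ * ((t - c₁ / Real.sqrt 2 : ℝ) : ℂ))) :
    ∫ t : ℝ, (f (c₂ + ρ * ((t - c₂ / Real.sqrt 2 : ℝ) : ℂ)) -
      f (c₁ + ρ * ((t - c₁ / Real.sqrt 2 : ℝ) : ℂ))) = 0 := by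
  have hs : 0 < Real.sqrt 2 := by positivity
  have hs2 : Real.sqrt 2 * Real.sqrt 2 = 2 := Real.mul_self_sqrt two_pos.le
  refine integral_eq_zero_of_tendsto hd ?_
  set a : ℝ := -(c₂ / Real.sqrt 2) with ha
  set b : ℝ := -(c₁ / Real.sqrt 2) with hb
  have hab : a ≤ b := by rw [ha, hb]; gcongr
  have hac : ∀ y ∈ Set.Icc a b, -(Real.sqrt 2 * y) ∈ Set.Icc c₁ c₂ := fun y hy => by
    have h1 := mul_le_mul_of_nonneg_left hy.1 hs.le
    have h2 := mul_le_mul_of_nonneg_left hy.2 hs.le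
    rw [ha, mul_neg, mul_div_cancel₀ _ hs.ne'] at h1
    rw [hb, mul_neg, mul_div_cancel₀ _ hs.ne'] at h2
    constructor <;> linarith
  have hline : ∀ t y : ℝ, f (ρ * (t + y * I)) = f (((-(Real.sqrt 2 * y) : ℝ) : ℂ) + ρ * ((t + y : ℝ) : ℂ)) :=
    fun t y => by rw [rho_mul_add_mul_I]
  have e1 : ∀ t : ℝ, f (c₂ + ρ * ((t - c₂ / Real.sqrt 2 : ℝ) : ℂ)) = f (ρ * (t + a * I)) := fun t => by
    rw [hline, ha, mul_neg, mul_div_cancel₀ _ hs.ne', neg_neg, sub_eq_add_neg]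
  have e2 : ∀ t : ℝ, f (c₁ + ρ * ((t - c₁ / Real.sqrt 2 : ℝ) : ℂ)) = f (ρ * (t + b * I)) := fun t => by
    rw [hline, hb, mul_neg, mul_div_cancel₀ _ hs.ne', neg_neg, sub_eq_add_neg]
  simp only [e1, e2]
  have hmaps : ∀ T : ℝ, Set.MapsTo (fun w : ℂ => ρ * w) (Set.uIcc (-T) T ×ℂ Set.uIcc a b)
      {z | z.re - z.im ∈ Set.Icc c₁ c₂} := fun T w hw => by
    have h1 := hac w.im (by rw [← Set.uIcc_of_le hab]; exact hw.2)
    have h2 := rho_mul_add_mul_I w.re w.im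
    rw [re_add_im] at h2
    change (ρ * w).re - (ρ * w).im ∈ Set.Icc c₁ c₂
    rw [h2, line_re, line_im, add_sub_cancel_right]
    exact h1
  have hdiff : ∀ T : ℝ, DifferentiableOn ℂ (fun w => f (ρ * w)) (Set.uIcc (-T) T ×ℂ Set.uIcc a b) := fun T =>
    hf.comp (differentiableOn_id.const_mul ρ) (hmaps T)
  have hrect : ∀ T : ℝ, ∫ t in -T..T, (f (ρ * (t + a * I)) - f (ρ * (t + b * I))) =
      I • (∫ y in a..b, f (ρ * ((-T : ℝ) + y * I))) - I • ∫ y in a..b, f (ρ * ((T : ℝ) + y * I)) := by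
    intro T
    have h := integral_boundary_rect_eq_zero_of_differentiableOn (fun w => f (ρ * w))
      ((-T : ℝ) + a * I) ((T : ℝ) + b * I) (by simpa using hdiff T)
    simp at h
    have hint : ∀ y ∈ Set.Icc a b, IntervalIntegrable (fun t : ℝ => f (ρ * (t + y * I))) volume (-T) T :=
      fun y hy => by
        refine ContinuousOn.intervalIntegrable ?_
        refine (hdiff T).continuousOn.comp (by fun_prop) fun t ht => ?_
        rw [mem_reProdIm]
        simpa [Set.uIcc_of_le hab] using And.intro ht hy
    rw [intervalIntegral.integral_sub (hint a (Set.left_mem_Icc.2 hab))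
      (hint b (Set.right_mem_Icc.2 hab))]
    simp only [smul_eq_mul]
    push_cast
    linear_combination h
  simp only [hrect]
  have hside : ∀ σ : ℝ, |σ| = 1 →
      Tendsto (fun T : ℝ => ∫ y in a..b, f (ρ * ((σ * T : ℝ) + y * I))) atTop (𝓝 0) := by
    intro σ hσ
    rw [Metric.tendsto_nhds]
    intro ε hε
    obtain ⟨U, hU⟩ := hdecay (ε / (2 * (b - a + 1))) (div_pos hε (by linarith))
    filter_upwards [eventually_ge_atTop (U + (|a| + |b|)), eventually_ge_atTop 0] with T hT hT0
    rw [dist_zero_right]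
    have hbd : ∀ y ∈ Set.uIoc a b, ‖f (ρ * ((σ * T : ℝ) + y * I))‖ ≤ ε / (2 * (b - a + 1)) := by
      intro y hy
      rw [Set.uIoc_of_le hab] at hy
      rw [hline]
      refine hU _ (hac y ⟨hy.1.le, hy.2⟩) _ ?_
      have h1 : |y| ≤ |a| + |b| := by
        rw [abs_le]
        constructor
        · linarith [neg_abs_le a, abs_nonneg b, hy.1]
        · linarith [le_abs_self b, abs_nonneg a, hy.2]
      have h2 : |σ * T| ≤ |σ * T + y| + |y| := by
        have := abs_sub (σ * T + y) y
        rwa [add_sub_cancel_right] at this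
      rw [abs_mul, hσ, one_mul, abs_of_nonneg hT0] at h2
      linarith
    refine (intervalIntegral.norm_integral_le_of_norm_le_const hbd).trans_lt ?_
    rw [abs_of_nonneg (by linarith), div_mul_eq_mul_div, div_lt_iff₀ (by linarith)]
    nlinarith
  have h1 := (hside (-1) (by norm_num)).const_smul I
  have h2 := (hside 1 (by norm_num)).const_smul I
  simpa using h1.sub h2

theorem integrable_of_norm_le_gaussian {g : ℝ → ℂ} (hg : Continuous g) {K A : ℝ} (hA : 0 < A)
    (h : ∀ u : ℝ, 1 ≤ |u| → ‖g u‖ ≤ K * Real.exp (-A * u ^ 2)) : Integrable g := by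
  refine hg.locallyIntegrable.integrable_of_isBigO_cocompact (g := fun u => Real.exp (-A * u ^ 2)) ?_
    ((integrable_exp_neg_mul_sq hA).integrableAtFilter _)
  refine Asymptotics.IsBigO.of_bound K ?_
  filter_upwards [(tendsto_norm_cocompact_atTop (E := ℝ)).eventually_ge_atTop 1] with u hu
  rw [Real.norm_of_nonneg (Real.exp_pos _).le]
  exact h u hu

theorem line_sub_mem (c u : ℝ) {c₁ c₂ : ℝ} (hc : c ∈ Set.Icc c₁ c₂) :
    (c + ρ * u : ℂ) ∈ {z : ℂ | z.re - z.im ∈ Set.Icc c₁ c₂} := by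
  change (c + ρ * u : ℂ).re - (c + ρ * u : ℂ).im ∈ Set.Icc c₁ c₂
  rwa [line_re, line_im, add_sub_cancel_right]

theorem continuous_line {f : ℂ → ℂ} {c₁ c₂ : ℝ}
    (hf : ContinuousOn f {z | z.re - z.im ∈ Set.Icc c₁ c₂}) {c : ℝ} (hc : c ∈ Set.Icc c₁ c₂) :
    Continuous fun u : ℝ => f (c + ρ * u) :=
  hf.comp_continuous (by fun_prop) fun u => line_sub_mem c u hc

theorem integral_line_eq_of_strip {f : ℂ → ℂ} {c₁ c₂ K A : ℝ} (hA : 0 < A) (hc : c₁ ≤ c₂)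
    (hf : DifferentiableOn ℂ f {z | z.re - z.im ∈ Set.Icc c₁ c₂})
    (hb : ∀ c ∈ Set.Icc c₁ c₂, ∀ u : ℝ, 1 ≤ |u| → ‖f (c + ρ * u)‖ ≤ K * Real.exp (-A * u ^ 2)) :
    ∫ u : ℝ, f (c₂ + ρ * u) = ∫ u : ℝ, f (c₁ + ρ * u) := by
  have hint : ∀ c ∈ Set.Icc c₁ c₂, Integrable fun u : ℝ => f (c + ρ * u) := fun c hcc =>
    integrable_of_norm_le_gaussian (continuous_line hf.continuousOn hcc) hA (hb c hcc)
  have h1 := hint c₁ (Set.left_mem_Icc.2 hc)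
  have h2 := hint c₂ (Set.right_mem_Icc.2 hc)
  have h1' := h1.comp_sub_right (c₁ / Real.sqrt 2)
  have h2' := h2.comp_sub_right (c₂ / Real.sqrt 2)
  have h := integral_sub_eq_zero_of_strip hf ?_ hc (h2'.sub h1')
  · rw [integral_sub h2' h1', sub_eq_zero,
      integral_sub_right_eq_self (fun u : ℝ => f (c₂ + ρ * u)),
      integral_sub_right_eq_self (fun u : ℝ => f (c₁ + ρ * u))] at h
    exact h
  · intro ε hε
    have ht : Tendsto (fun r : ℝ => K * Real.exp (-A * r ^ 2)) atTop (𝓝 (K * 0)) := by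
      refine (Real.tendsto_exp_atBot.comp ?_).const_mul K
      exact (tendsto_pow_atTop two_ne_zero).const_mul_atTop_of_neg (neg_neg_of_pos hA)
    rw [mul_zero] at ht
    obtain ⟨U, hU⟩ := eventually_atTop.1 (ht.eventually_le_const hε)
    refine ⟨max U 1, fun c hcc u hu => (hb c hcc u ((le_max_right _ _).trans hu)).trans ?_⟩
    have := hU |u| ((le_max_left _ _).trans hu)
    rwa [sq_abs] at this

theorem integral_poisson_kernel {κ : ℝ} (hκ : 0 < κ) (r : ℝ) :
    (Integrable fun t : ℝ => κ / ((t - r) ^ 2 + κ ^ 2)) ∧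
      ∫ t : ℝ, κ / ((t - r) ^ 2 + κ ^ 2) = Real.pi := by
  have e : ∀ v : ℝ, κ / (v ^ 2 + κ ^ 2) = κ⁻¹ * (1 + (κ⁻¹ * v) ^ 2)⁻¹ := fun v => by
    have : 0 < v ^ 2 + κ ^ 2 := by positivity
    have : 0 < 1 + (κ⁻¹ * v) ^ 2 := by positivity
    field_simp
    ring
  have hi : Integrable fun v : ℝ => κ / (v ^ 2 + κ ^ 2) := by
    simp only [e]
    exact (integrable_inv_one_add_sq.comp_mul_left' (inv_ne_zero hκ.ne')).const_mul _
  refine ⟨hi.comp_sub_right r, ?_⟩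
  rw [integral_sub_right_eq_self (fun v : ℝ => κ / (v ^ 2 + κ ^ 2))]
  simp only [e]
  rw [integral_const_mul, Measure.integral_comp_mul_left (fun v : ℝ => (1 + v ^ 2)⁻¹) κ⁻¹,
    integral_univ_inv_one_add_sq, inv_inv, abs_of_pos hκ, smul_eq_mul, inv_mul_cancel_left₀ hκ.ne']

/-- Residue theorem for an oblique strip with one simple pole on its midline. -/
theorem integral_line_sub_eq_residue {f G : ℂ → ℂ} {a K A : ℝ} (hA : 0 < A)
    (hG : DifferentiableOn ℂ G {z | z.re - z.im ∈ Set.Icc (a - 1 / 2) (a + 1 / 2)})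
    (hfG : ∀ z : ℂ, z.re - z.im ∈ Set.Icc (a - 1 / 2) (a + 1 / 2) → z ≠ a → f z = G z / (z - a))
    (hb : ∀ c ∈ Set.Icc (a - 1 / 2) (a + 1 / 2), ∀ u : ℝ, 1 ≤ |u| →
      ‖f (c + ρ * u)‖ ≤ K * Real.exp (-A * u ^ 2)) :
    (∫ u : ℝ, f ((a + 1 / 2 : ℝ) + ρ * u)) - ∫ u : ℝ, f ((a - 1 / 2 : ℝ) + ρ * u) =
      ρ⁻¹ * (2 * Real.pi * I) * G a := by
  have hs : 0 < Real.sqrt 2 := by positivity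
  have hs2 : (Real.sqrt 2 : ℂ) ^ 2 = 2 := by
    rw [← ofReal_pow, Real.sq_sqrt two_pos.le]; simp
  have hs0 : (Real.sqrt 2 : ℂ) ≠ 0 := ofReal_ne_zero.2 hs.ne'
  set S : Set ℂ := {z | z.re - z.im ∈ Set.Icc (a - 1 / 2) (a + 1 / 2)} with hS
  have hnhds : S ∈ 𝓝 (a : ℂ) := by
    refine mem_of_superset ((IsOpen.preimage (continuous_re.sub continuous_im)
      isOpen_Ioo).mem_nhds (?_ : (a : ℂ) ∈ _ ⁻¹' Set.Ioo (a - 1 / 2) (a + 1 / 2))) ?_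
    · simp
    · exact fun z hz => Set.Ioo_subset_Icc_self hz
  have hD := (differentiableOn_dslope hnhds).2 hG
  have hDeq : ∀ z ∈ S, z ≠ a → dslope G a z = f z - G a * (z - a)⁻¹ := fun z hz hza => by
    rw [dslope_of_ne _ hza, slope_def_field, hfG z hz hza, sub_div, div_eq_mul_inv (G a)]
  have hne : ∀ c u : ℝ, u ≠ 0 ∨ c ≠ a → (c + ρ * u : ℂ) ≠ a := fun c u h h' => by
    have h1 := congrArg re h'
    have h2 := congrArg im h'
    rw [line_re, ofReal_re] at h1
    rw [line_im, ofReal_im, div_eq_zero_iff, or_iff_left hs.ne'] at h2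
    rw [h2] at h1
    rcases h with h | h
    · exact h h2
    · exact h (by simpa using h1)
  have h1m : a - 1 / 2 ∈ Set.Icc (a - 1 / 2) (a + 1 / 2) := ⟨le_rfl, by linarith⟩
  have h2m : a + 1 / 2 ∈ Set.Icc (a - 1 / 2) (a + 1 / 2) := ⟨by linarith, le_rfl⟩
  have hfc : ∀ c ∈ Set.Icc (a - 1 / 2) (a + 1 / 2), c ≠ a → Continuous fun u : ℝ => f (c + ρ * u) := by
    intro c hc hca
    have : (fun u : ℝ => f (c + ρ * u)) = fun u : ℝ => G (c + ρ * u) / (c + ρ * u - a) :=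
      funext fun u => hfG _ (line_sub_mem c u hc) (hne c u (.inr hca))
    rw [this]
    exact (continuous_line hG.continuousOn hc).div (by fun_prop) fun u =>
      sub_ne_zero.2 (hne c u (.inr hca))
  have i1 := (integrable_of_norm_le_gaussian (hfc _ h1m (by linarith)) hA (hb _ h1m)).comp_sub_right
    ((a - 1 / 2) / Real.sqrt 2)
  have i2 := (integrable_of_norm_le_gaussian (hfc _ h2m (by linarith)) hA (hb _ h2m)).comp_sub_right
    ((a + 1 / 2) / Real.sqrt 2)
  set κ : ℝ := 1 / (2 * Real.sqrt 2) with hκ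
  have hκ0 : 0 < κ := by positivity
  obtain ⟨i3, hi3⟩ := integral_poisson_kernel hκ0 (a / Real.sqrt 2)
  have i4 : Integrable fun t : ℝ => G a * (ρ⁻¹ * (2 * I)) *
      ((κ / ((t - a / Real.sqrt 2) ^ 2 + κ ^ 2) : ℝ) : ℂ) := i3.ofReal.const_mul _
  have hpole : ∀ t : ℝ,
      dslope G a ((a + 1 / 2 : ℝ) + ρ * ((t - (a + 1 / 2) / Real.sqrt 2 : ℝ) : ℂ)) -
        dslope G a ((a - 1 / 2 : ℝ) + ρ * ((t - (a - 1 / 2) / Real.sqrt 2 : ℝ) : ℂ)) =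
      f ((a + 1 / 2 : ℝ) + ρ * ((t - (a + 1 / 2) / Real.sqrt 2 : ℝ) : ℂ)) -
        f ((a - 1 / 2 : ℝ) + ρ * ((t - (a - 1 / 2) / Real.sqrt 2 : ℝ) : ℂ)) -
        G a * (ρ⁻¹ * (2 * I)) * ((κ / ((t - a / Real.sqrt 2) ^ 2 + κ ^ 2) : ℝ) : ℂ) := by
    intro t
    rw [hDeq _ (line_sub_mem _ _ h2m) (hne _ _ (.inr (by linarith))),
      hDeq _ (line_sub_mem _ _ h1m) (hne _ _ (.inr (by linarith)))]
    have n2 := sub_ne_zero.2 (hne (a + 1 / 2) (t - (a + 1 / 2) / Real.sqrt 2) (.inr (by linarith)))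
    have n1 := sub_ne_zero.2 (hne (a - 1 / 2) (t - (a - 1 / 2) / Real.sqrt 2) (.inr (by linarith)))
    have hρr : ρ / Real.sqrt 2 = (1 + I) / 2 := by
      rw [rho_eq, div_div, ← sq, hs2]
    have hρκ : ρ * κ = (1 + I) / 4 := by
      rw [hκ]
      push_cast
      linear_combination hρr / 2
    set v : ℝ := t - a / Real.sqrt 2 with hv
    have e2 : ((a + 1 / 2 : ℝ) + ρ * ((t - (a + 1 / 2) / Real.sqrt 2 : ℝ) : ℂ)) - a =
        ρ * (v - κ * I) := by
      rw [hv]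
      push_cast
      linear_combination (-1 / 2) * hρr + I * hρκ + I_sq / 4
    have e1 : ((a - 1 / 2 : ℝ) + ρ * ((t - (a - 1 / 2) / Real.sqrt 2 : ℝ) : ℂ)) - a =
        ρ * (v + κ * I) := by
      rw [hv]
      push_cast
      linear_combination (1 / 2) * hρr - I * hρκ - I_sq / 4
    rw [e2] at n2 ⊢
    rw [e1] at n1 ⊢
    have m2 := right_ne_zero_of_mul n2
    have m1 := right_ne_zero_of_mul n1
    have m3 : (v : ℂ) ^ 2 + (κ : ℂ) ^ 2 ≠ 0 := by
      have : (v : ℂ) ^ 2 + (κ : ℂ) ^ 2 = (v - κ * I) * (v + κ * I) := by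
        linear_combination ((κ : ℂ) ^ 2) * I_sq
      rw [this]
      exact mul_ne_zero m2 m1
    have key : (ρ * (v - κ * I) : ℂ)⁻¹ - (ρ * (v + κ * I))⁻¹ =
        ρ⁻¹ * (2 * I) * (κ / (v ^ 2 + κ ^ 2)) := by
      have hρ := rho_ne_zero
      field_simp
      linear_combination (2 * I * (κ : ℂ) ^ 3) * I_sq
    push_cast
    linear_combination (-G a) * key
  have h := integral_sub_eq_zero_of_strip hD ?_ (by linarith) ?_
  · simp only [hpole] at h
    have e := integral_sub (i2.sub i1) i4
    simp only [Pi.sub_apply] at e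
    rw [e, integral_sub i2 i1,
      integral_sub_right_eq_self (fun u : ℝ => f ((a + 1 / 2 : ℝ) + ρ * u)),
      integral_sub_right_eq_self (fun u : ℝ => f ((a - 1 / 2 : ℝ) + ρ * u)),
      integral_const_mul, integral_complex_ofReal, hi3] at h
    linear_combination h
  · intro ε hε
    have ht : Tendsto (fun r : ℝ => K * Real.exp (-A * r ^ 2) + ‖G a‖ * (Real.sqrt 2 / r)) atTop
        (𝓝 (K * 0 + ‖G a‖ * 0)) := by
      refine ((Real.tendsto_exp_atBot.comp ?_).const_mul K).add
        ((tendsto_const_nhds.div_atTop tendsto_id).const_mul _)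
      exact (tendsto_pow_atTop two_ne_zero).const_mul_atTop_of_neg (neg_neg_of_pos hA)
    rw [mul_zero, mul_zero, add_zero] at ht
    obtain ⟨U, hU⟩ := eventually_atTop.1 (ht.eventually_le_const hε)
    refine ⟨max U 1, fun c hcc u hu => ?_⟩
    have hu1 : 1 ≤ |u| := (le_max_right _ _).trans hu
    have h1 := hU |u| ((le_max_left _ _).trans hu)
    rw [sq_abs] at h1
    have hu0 : u ≠ 0 := abs_pos.1 (by linarith)
    rw [hDeq _ (line_sub_mem _ _ hcc) (hne _ _ (.inl hu0))]
    refine (norm_sub_le _ _).trans ((add_le_add (hb c hcc u hu1) ?_).trans h1)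
    rw [norm_mul, norm_inv]
    gcongr
    rw [inv_le_comm₀ (norm_pos_iff.2 (sub_ne_zero.2 (hne c u (.inl hu0)))) (by positivity), inv_div]
    have := abs_im_le_norm (c + ρ * u - a : ℂ)
    rwa [sub_im, line_im, ofReal_im, sub_zero, abs_div, abs_of_pos hs] at this
  · simp only [hpole]
    exact (i2.sub i1).sub i4

/-- The integrand of the contour integral representing the partial sums of `F_1`. -/
noncomputable def contourKernel (x : ℝ) (z : ℂ) : ℂ :=
  exp (Real.pi * I * z ^ 2 * x) / (z * (1 - exp (2 * Real.pi * I * z)))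

theorem norm_exp_quadratic (x k c u : ℝ) :
    ‖exp (Real.pi * I * (c + ρ * u) ^ 2 * x - 2 * Real.pi * I * k * (c + ρ * u))‖ =
      Real.exp (-(Real.pi * x * u ^ 2) - Real.sqrt 2 * Real.pi * u * (x * c - k)) := by
  have hs : Real.sqrt 2 ^ 2 = 2 := Real.sq_sqrt two_pos.le
  have hs0 : Real.sqrt 2 ≠ 0 := by positivity
  have e : (Real.pi * I * (c + ρ * u) ^ 2 * x - 2 * Real.pi * I * k * (c + ρ * u) : ℂ) =
      ((Real.pi * x * c ^ 2 - 2 * Real.pi * k * c : ℝ) : ℂ) * I - ((Real.pi * x * u ^ 2 : ℝ) : ℂ) +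
        ((2 * Real.pi * u * (x * c - k) : ℝ) : ℂ) * (I * ρ) := by
    push_cast
    linear_combination (Real.pi * I * x * u ^ 2) * rho_sq + (Real.pi * x * u ^ 2) * I_sq
  rw [norm_exp, e]
  congr 1
  rw [add_re, sub_re, re_ofReal_mul, re_ofReal_mul, I_mul_re, rho_im, I_re, ofReal_re]
  field_simp
  linear_combination (u * (x * c - k)) * hs

theorem norm_exp_two_pi_line (c u : ℝ) :
    ‖exp (2 * Real.pi * I * (c + ρ * u))‖ = Real.exp (-(Real.sqrt 2 * Real.pi * u)) := by
  have h := norm_exp_quadratic 0 (-1) c u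
  simp only [ofReal_zero, mul_zero, zero_sub, ofReal_neg, ofReal_one] at h
  convert h using 2
  · congr 1; ring
  · ring

theorem two_le_exp {t : ℝ} (ht : 1 ≤ t) : 2 ≤ Real.exp t := by
  linarith [Real.add_one_le_exp t]

theorem norm_one_sub_exp_ge (c : ℝ) {u : ℝ} (hu : 1 ≤ |u|) :
    1 / 2 ≤ ‖1 - exp (2 * Real.pi * I * (c + ρ * u))‖ := by
  have hn := norm_exp_two_pi_line c u
  have hs : 1 ≤ Real.sqrt 2 := Real.one_le_sqrt.2 one_le_two
  have hp : 1 ≤ Real.sqrt 2 * Real.pi := by nlinarith [Real.pi_gt_three]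
  rcases le_abs.1 hu with h | h
  · have h1 := norm_sub_norm_le (1 : ℂ) (exp (2 * Real.pi * I * (c + ρ * u)))
    have h2 := two_le_exp (t := Real.sqrt 2 * Real.pi * u) (by nlinarith)
    rw [hn, Real.exp_neg, norm_one] at h1
    have h3 := inv_anti₀ two_pos h2
    linarith
  · have h1 := norm_sub_norm_le (exp (2 * Real.pi * I * (c + ρ * u))) 1
    have h2 := two_le_exp (t := -(Real.sqrt 2 * Real.pi * u)) (by nlinarith)
    rw [norm_sub_rev, hn, norm_one] at h1
    linarith

theorem norm_line_ge_im (c u : ℝ) : |u| / Real.sqrt 2 ≤ ‖(c + ρ * u : ℂ)‖ := by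
  have h := abs_im_le_norm (c + ρ * u : ℂ)
  rwa [line_im, abs_div, abs_of_nonneg (Real.sqrt_nonneg 2)] at h

theorem norm_line_ge (c u : ℝ) : |c| / Real.sqrt 2 ≤ ‖(c + ρ * u : ℂ)‖ := by
  have hs : 0 < Real.sqrt 2 := by positivity
  rw [div_le_iff₀ hs, mul_comm]
  refine abs_le_of_sq_le_sq ?_ (by positivity)
  rw [mul_pow, Real.sq_sqrt two_pos.le, ← normSq_eq_norm_sq, normSq_apply, line_re, line_im]
  nlinarith [sq_nonneg (c + 2 * (u / Real.sqrt 2))]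

theorem exp_quadratic_le {x : ℝ} (hx : 0 < x) {k c C : ℝ} (hC : |x * c - k| ≤ C) (u : ℝ) :
    Real.exp (-(Real.pi * x * u ^ 2) - Real.sqrt 2 * Real.pi * u * (x * c - k)) ≤
      Real.exp (Real.pi * C ^ 2 / x) * Real.exp (-(Real.pi * x / 2) * u ^ 2) := by
  rw [← Real.exp_add]
  gcongr
  have hs : Real.sqrt 2 ^ 2 = 2 := Real.sq_sqrt two_pos.le
  have h1 : (x * c - k) ^ 2 ≤ C ^ 2 := sq_le_sq' (abs_le.1 hC).1 (abs_le.1 hC).2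
  have h2 : Real.pi * (x * c - k) ^ 2 / x ≤ Real.pi * C ^ 2 / x := by gcongr
  have h3 : 0 ≤ Real.pi / (2 * x) * (x * u + Real.sqrt 2 * (x * c - k)) ^ 2 := by positivity
  have h4 : Real.pi / (2 * x) * (x * u + Real.sqrt 2 * (x * c - k)) ^ 2 =
      Real.pi * x / 2 * u ^ 2 + Real.sqrt 2 * Real.pi * u * (x * c - k) +
        Real.pi * (x * c - k) ^ 2 / x := by
    field_simp
    rw [add_sq, mul_pow _ (x * c - k), hs]
    ring
  linarith

theorem norm_contourKernel_le {x : ℝ} (hx : 0 < x) {c C : ℝ} (hC : |c| ≤ C) {u : ℝ}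
    (hu : 1 ≤ |u|) :
    ‖contourKernel x (c + ρ * u)‖ ≤
      (2 * Real.sqrt 2 * Real.exp (Real.pi * (x * C) ^ 2 / x)) *
        Real.exp (-(Real.pi * x / 2) * u ^ 2) := by
  have hs : 0 < Real.sqrt 2 := by positivity
  have h1 := norm_exp_quadratic x 0 c u
  simp only [ofReal_zero, mul_zero, zero_mul, sub_zero] at h1
  have h2 := exp_quadratic_le hx (k := 0) (c := c) (C := x * C)
    (by rw [sub_zero, abs_mul, abs_of_pos hx]; gcongr) u
  rw [sub_zero] at h2
  have h3 := norm_one_sub_exp_ge c hu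
  have h4 : 1 / Real.sqrt 2 ≤ ‖(c + ρ * u : ℂ)‖ :=
    (by gcongr : 1 / Real.sqrt 2 ≤ |u| / Real.sqrt 2).trans (norm_line_ge_im c u)
  rw [contourKernel, norm_div, norm_mul, h1]
  calc _ ≤ Real.exp (Real.pi * (x * C) ^ 2 / x) * Real.exp (-(Real.pi * x / 2) * u ^ 2) /
        (1 / Real.sqrt 2 * (1 / 2)) := by gcongr
    _ = _ := by field_simp

theorem exp_two_pi_eq_one {z : ℂ} (h : exp (2 * Real.pi * I * z) = 1) : ∃ m : ℤ, z = m := by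
  obtain ⟨m, hm⟩ := exp_eq_one_iff.1 h
  refine ⟨m, mul_left_cancel₀ two_pi_I_ne_zero ?_⟩
  rw [hm]; ring

theorem integral_contourKernel_sub {x : ℝ} (hx : 0 < x) {n : ℕ} (hn : 1 ≤ n) :
    (∫ u : ℝ, contourKernel x ((n + 1 / 2 : ℝ) + ρ * u)) -
      ∫ u : ℝ, contourKernel x ((n - 1 / 2 : ℝ) + ρ * u) =
    -(ρ⁻¹ * (exp (Real.pi * I * n ^ 2 * x) / n)) := by
  have hn1 : (1 : ℝ) ≤ n := by exact_mod_cast hn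
  set e : ℂ → ℂ := fun z => 1 - exp (2 * Real.pi * I * z) with he
  have hed : Differentiable ℂ e := by fun_prop
  have hen : e n = 0 := by
    have := exp_int_mul_two_pi_mul_I n
    rw [he]
    simp only
    rw [show (2 * Real.pi * I * n : ℂ) = (n : ℤ) * (2 * Real.pi * I) by push_cast; ring, this, sub_self]
  have hder : dslope e n n = -(2 * Real.pi * I) := by
    rw [dslope_same]
    have h1 : HasDerivAt e (-(exp (2 * Real.pi * I * n) * (2 * Real.pi * I * 1))) (n : ℂ) :=
      (((hasDerivAt_id (n : ℂ)).const_mul (2 * Real.pi * I)).cexp).const_sub 1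
    rw [h1.deriv, (sub_eq_zero.1 hen).symm]
    ring
  have hE : ∀ z, e z = (z - n) * dslope e n z := fun z => by
    have := sub_smul_dslope e (n : ℂ) z
    rw [smul_eq_mul, hen, sub_zero] at this
    exact this.symm
  have hEd : Differentiable ℂ (dslope e n) := fun z =>
    ((differentiableOn_dslope univ_mem).2 hed.differentiableOn).differentiableAt univ_mem
  have hE0 : ∀ z : ℂ, z.re - z.im ∈ Set.Icc ((n : ℝ) - 1 / 2) (n + 1 / 2) → dslope e n z ≠ 0 := by
    intro z hz h0
    by_cases hzn : z = n
    · rw [hzn, hder] at h0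
      exact two_pi_I_ne_zero (neg_eq_zero.1 h0)
    · have h1 : e z = 0 := by rw [hE, h0, mul_zero]
      obtain ⟨m, rfl⟩ := exp_two_pi_eq_one (sub_eq_zero.1 h1).symm
      simp only [intCast_re, intCast_im, sub_zero] at hz
      have h2 : (m : ℝ) < ((n : ℤ) + 1 : ℤ) := by push_cast; linarith [hz.2]
      have h3 : (((n : ℤ) - 1 : ℤ) : ℝ) < m := by push_cast; linarith [hz.1]
      have h4 : m = n := by have := Int.cast_lt.1 h2; have := Int.cast_lt.1 h3; omega
      exact hzn (by rw [h4]; simp)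
  have hz0 : ∀ z : ℂ, z.re - z.im ∈ Set.Icc ((n : ℝ) - 1 / 2) (n + 1 / 2) → z ≠ 0 := by
    rintro z hz rfl
    simp at hz
    linarith [hz.1]
  have h := integral_line_sub_eq_residue (f := contourKernel x) (a := n)
    (G := fun z => exp (Real.pi * I * z ^ 2 * x) / (z * dslope e n z))
    (K := 2 * Real.sqrt 2 * Real.exp (Real.pi * (x * (n + 1 / 2)) ^ 2 / x))
    (A := Real.pi * x / 2) (by positivity) ?_ ?_ ?_
  · rw [h]
    simp only [ofReal_natCast]
    rw [hder]
    have : (n : ℂ) ≠ 0 := by exact_mod_cast (by omega : n ≠ 0)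
    have hpi := two_pi_I_ne_zero
    field_simp
  · refine DifferentiableOn.div (by fun_prop) (differentiableOn_id.mul hEd.differentiableOn) ?_
    exact fun z hz => mul_ne_zero (hz0 z hz) (hE0 z hz)
  · intro z hz hzn
    rw [contourKernel]
    change _ / (z * e z) = _
    rw [hE z, ofReal_natCast, div_div]
    congr 1; ring
  · intro c hc u hu
    exact norm_contourKernel_le hx (abs_le.2 ⟨by linarith [hc.1], hc.2⟩) hu

theorem Fpart_one_zero (n : ℕ) (x : ℝ) :
    Fpart 1 n x 0 = ∑ k ∈ Finset.Icc 1 n, exp (Real.pi * I * k ^ 2 * x) / k := by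
  simp [Fpart]

theorem Fpart_eq_integral_sub {x : ℝ} (hx : 0 < x) (n : ℕ) :
    Fpart 1 n x 0 = ρ * (∫ u : ℝ, contourKernel x ((1 / 2 : ℝ) + ρ * u)) -
      ρ * ∫ u : ℝ, contourKernel x ((n + 1 / 2 : ℝ) + ρ * u) := by
  induction n with
  | zero => simp [Fpart]
  | succ n ih =>
    rw [Fpart_one_zero, Finset.sum_Icc_succ_top (by omega), ← Fpart_one_zero, ih]
    have h := integral_contourKernel_sub hx (n := n + 1) (by omega)
    rw [show ((n + 1 : ℕ) : ℝ) - 1 / 2 = n + 1 / 2 by push_cast; ring] at h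
    linear_combination ρ * h - (exp (Real.pi * I * ((n + 1 : ℕ) : ℂ) ^ 2 * x) / ((n + 1 : ℕ) : ℂ)) *
      mul_inv_cancel₀ rho_ne_zero

theorem integrable_abs_mul_exp_neg_mul_sq {b : ℝ} (hb : 0 < b) :
    Integrable fun u : ℝ => |u| * Real.exp (-b * u ^ 2) := by
  refine (integrable_mul_exp_neg_mul_sq hb).abs.congr (ae_of_all _ fun u => ?_)
  simp only [abs_mul, Real.abs_exp]

theorem integral_abs_mul_exp_neg_mul_sq {b : ℝ} (hb : 0 < b) :
    ∫ u : ℝ, |u| * Real.exp (-b * u ^ 2) = 1 / b := by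
  have h := integral_comp_abs (f := fun u : ℝ => u * Real.exp (-b * u ^ 2))
  simp only [sq_abs] at h
  rw [h]
  have h2 := integral_mul_cexp_neg_mul_sq (b := b) (by simpa using hb)
  have h3 : ∫ r in Set.Ioi (0 : ℝ), ((r * Real.exp (-b * r ^ 2) : ℝ) : ℂ) = (2 * (b : ℂ))⁻¹ := by
    rw [← h2]
    simp
  rw [integral_complex_ofReal] at h3
  have h4 : ((∫ r in Set.Ioi (0 : ℝ), r * Real.exp (-b * r ^ 2) : ℝ) : ℂ) = ((2 * b)⁻¹ : ℝ) := by
    rw [h3]; simp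
  rw [ofReal_inj.1 h4]
  field_simp

/-- Integrand of the `k`-th correction term in the second part of `Ifun`. -/
noncomputable def dualIntegrand (x : ℝ) (k : ℕ) (u : ℝ) : ℂ :=
  (Real.exp (-(Real.pi * x * u ^ 2)) : ℝ) *
    (exp (-(Real.pi * I * k ^ 2 / x)) * ((ρ * x * u + k)⁻¹ - (k : ℂ)⁻¹))

noncomputable def dualTerm (x : ℝ) (k : ℕ) : ℂ := ρ * x * ∫ u : ℝ, dualIntegrand x k u

theorem norm_rho_mul_add_ge (x u : ℝ) (k : ℕ) : k / Real.sqrt 2 ≤ ‖(ρ * x * u + k : ℂ)‖ := by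
  have h := norm_line_ge k (x * u)
  rw [abs_of_nonneg (Nat.cast_nonneg k)] at h
  convert h using 2
  push_cast; ring

theorem rho_mul_add_ne_zero (x u : ℝ) {k : ℕ} (hk : 1 ≤ k) : (ρ * x * u + k : ℂ) ≠ 0 := by
  have hk0 : (0 : ℝ) < k := by exact_mod_cast hk
  exact norm_pos_iff.1 ((by positivity : 0 < k / Real.sqrt 2).trans_le (norm_rho_mul_add_ge x u k))

theorem norm_exp_neg_div (x : ℝ) (k : ℕ) : ‖exp (-(Real.pi * I * k ^ 2 / x))‖ = 1 := by
  rw [show (-(Real.pi * I * k ^ 2 / x) : ℂ) = ((-(Real.pi * k ^ 2 / x) : ℝ) : ℂ) * I by push_cast; ring,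
    norm_exp_ofReal_mul_I]

theorem norm_dualIntegrand_le {x : ℝ} (hx : 0 < x) {k : ℕ} (hk : 1 ≤ k) (u : ℝ) :
    ‖dualIntegrand x k u‖ ≤ Real.sqrt 2 * x / k ^ 2 * (|u| * Real.exp (-(Real.pi * x) * u ^ 2)) := by
  have hk0 : (0 : ℝ) < k := by exact_mod_cast hk
  have hkc : (k : ℂ) ≠ 0 := by exact_mod_cast hk0.ne'
  have hs : 0 < Real.sqrt 2 := by positivity
  have hn := norm_rho_mul_add_ge x u k
  have h0 := rho_mul_add_ne_zero x u hk
  rw [dualIntegrand, norm_mul, norm_mul, norm_exp_neg_div, norm_real,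
    Real.norm_of_nonneg (Real.exp_pos _).le, inv_sub_inv h0 hkc, norm_div, norm_mul,
    show (k - (ρ * x * u + k) : ℂ) = -(ρ * x * u) by ring, norm_neg, norm_mul, norm_mul, norm_rho,
    norm_real, norm_real, Real.norm_of_nonneg hx.le, Real.norm_eq_abs, norm_natCast, one_mul, one_mul]
  calc _ ≤ Real.exp (-(Real.pi * x * u ^ 2)) * (x * |u| / (k / Real.sqrt 2 * k)) := by gcongr
    _ = _ := by rw [neg_mul]; field_simp

theorem continuous_dualIntegrand (x : ℝ) {k : ℕ} (hk : 1 ≤ k) : Continuous (dualIntegrand x k) := by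
  unfold dualIntegrand
  refine Continuous.mul (by fun_prop) (continuous_const.mul (Continuous.sub ?_ continuous_const))
  exact Continuous.inv₀ (by fun_prop) fun u => rho_mul_add_ne_zero x u hk

theorem integrable_dualIntegrand {x : ℝ} (hx : 0 < x) {k : ℕ} (hk : 1 ≤ k) :
    Integrable (dualIntegrand x k) :=
  ((integrable_abs_mul_exp_neg_mul_sq (by positivity : 0 < Real.pi * x)).const_mul _).mono'
    (continuous_dualIntegrand x hk).aestronglyMeasurable
    (ae_of_all _ fun u => norm_dualIntegrand_le hx hk u)

theorem integral_norm_dualIntegrand_le {x : ℝ} (hx : 0 < x) {k : ℕ} (hk : 1 ≤ k) :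
    ∫ u, ‖dualIntegrand x k u‖ ≤ 1 / k ^ 2 := by
  have hk0 : (0 : ℝ) < k := by exact_mod_cast hk
  have hb : 0 < Real.pi * x := by positivity
  refine (integral_mono (integrable_dualIntegrand hx hk).norm
    ((integrable_abs_mul_exp_neg_mul_sq hb).const_mul _)
    fun u => norm_dualIntegrand_le hx hk u).trans ?_
  rw [integral_const_mul, integral_abs_mul_exp_neg_mul_sq hb]
  have h : Real.sqrt 2 ≤ Real.pi := by
    have : Real.sqrt 2 ≤ 2 := Real.sqrt_le_iff.2 ⟨by norm_num, by norm_num⟩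
    linarith [Real.pi_gt_three]
  calc Real.sqrt 2 * x / (k : ℝ) ^ 2 * (1 / (Real.pi * x)) = Real.sqrt 2 / Real.pi * (1 / (k : ℝ) ^ 2) := by
        field_simp
    _ ≤ 1 * (1 / (k : ℝ) ^ 2) := by
        gcongr
        exact (div_le_one Real.pi_pos).2 h
    _ = _ := one_mul _

theorem norm_dualTerm_le {x : ℝ} (hx : 0 < x) {k : ℕ} (hk : 1 ≤ k) :
    ‖dualTerm x k‖ ≤ x * (1 / k ^ 2) := by
  rw [dualTerm, norm_mul, norm_mul, norm_rho, norm_real, Real.norm_of_nonneg hx.le, one_mul]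
  gcongr
  exact (norm_integral_le_integral_norm _).trans (integral_norm_dualIntegrand_le hx hk)

theorem hasSum_dualTerm {x : ℝ} (hx : 0 < x) :
    HasSum (fun k : ℕ => dualTerm x (k + 1)) (ρ * x * ∫ u : ℝ, ∑' k : ℕ, dualIntegrand x (k + 1) u) := by
  refine (hasSum_integral_of_summable_integral_norm
    (fun k => integrable_dualIntegrand hx (Nat.succ_pos k)) ?_).mul_left (ρ * x)
  refine Summable.of_nonneg_of_le (fun k => integral_nonneg fun u => norm_nonneg _)
    (fun k => integral_norm_dualIntegrand_le hx (Nat.succ_pos k)) ?_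
  exact (summable_nat_add_iff 1).2 (Real.summable_one_div_nat_pow.2 one_lt_two)

theorem hasSum_Ifun {x : ℝ} (hx : 0 < x) :
    HasSum (fun k : ℕ => dualTerm x (k + 1))
      (Ifun 1 x 0 - ρ * ∫ u : ℝ, contourKernel x ((1 / 2 : ℝ) + ρ * u)) := by
  convert hasSum_dualTerm hx using 1
  rw [Ifun, sub_eq_iff_eq_add']
  simp only [contourKernel, dualIntegrand, Int.fract_zero, ofReal_zero, mul_zero, add_zero, sub_zero,
    ofReal_one, cpow_one, integral_const_mul, tsum_mul_left]
  push_cast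
  rfl

theorem integral_dualShift {x : ℝ} (hx : 0 < x) {k : ℕ} (hk : 1 ≤ k) {c : ℝ} (hc : k ≤ x * c) :
    ρ * ∫ u : ℝ, exp (Real.pi * I * (c + ρ * u) ^ 2 * x - 2 * Real.pi * I * (k : ℝ) * (c + ρ * u)) /
        (c + ρ * u) =
      dualTerm x k + ρ * Real.sqrt x * (exp (-(Real.pi * I * k ^ 2 / x)) / k) := by
  have hk0 : (0 : ℝ) < k := by exact_mod_cast hk
  have hs : 0 < Real.sqrt 2 := by positivity
  have hxc : (x : ℂ) ≠ 0 := ofReal_ne_zero.2 hx.ne'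
  have hkx : 0 < k / x := by positivity
  have hc' : k / x ≤ c := (div_le_iff₀ hx).2 (by linarith)
  have h := integral_line_eq_of_strip (c₁ := k / x) (c₂ := c)
    (f := fun z => exp (Real.pi * I * z ^ 2 * x - 2 * Real.pi * I * (k : ℝ) * z) / z)
    (K := Real.sqrt 2 * Real.exp (Real.pi * (x * c) ^ 2 / x)) (A := Real.pi * x / 2)
    (by positivity) hc' ?_ ?_
  · rw [h]
    have e : ∀ u : ℝ, exp (Real.pi * I * ((k / x : ℝ) + ρ * u) ^ 2 * x -
        2 * Real.pi * I * (k : ℝ) * ((k / x : ℝ) + ρ * u)) / ((k / x : ℝ) + ρ * u) =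
        x * dualIntegrand x k u +
          (x * (exp (-(Real.pi * I * k ^ 2 / x)) / k)) *
            ((Real.exp (-(Real.pi * x) * u ^ 2) : ℝ) : ℂ) := by
      intro u
      have h1 : (Real.pi * I * ((k / x : ℝ) + ρ * u) ^ 2 * x -
        2 * Real.pi * I * (k : ℝ) * ((k / x : ℝ) + ρ * u) : ℂ) =
          ((-(Real.pi * x * u ^ 2) : ℝ) : ℂ) + -(Real.pi * I * k ^ 2 / x) := by
        push_cast
        field_simp
        linear_combination (x ^ 2 * u ^ 2 * I) * rho_sq + (x ^ 2 * u ^ 2) * I_sq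
      have h2 : ((k / x : ℝ) + ρ * u : ℂ) = (ρ * x * u + k) / x := by
        push_cast
        field_simp
        ring
      have h3 := rho_mul_add_ne_zero x u hk
      rw [h1, h2, exp_add, ← ofReal_exp, dualIntegrand, neg_mul]
      field_simp
      ring
    simp only [e]
    have hb : 0 < Real.pi * x := by positivity
    have hi : Integrable fun u : ℝ => ((Real.exp (-(Real.pi * x) * u ^ 2) : ℝ) : ℂ) :=
      (integrable_exp_neg_mul_sq hb).ofReal
    rw [integral_add ((integrable_dualIntegrand hx hk).const_mul _) (hi.const_mul _), integral_const_mul, integral_const_mul,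
      integral_complex_ofReal, integral_gaussian, dualTerm]
    have h4 : (x : ℂ) * (Real.sqrt (Real.pi / (Real.pi * x)) : ℝ) = (Real.sqrt x : ℝ) := by
      rw [← ofReal_mul, div_mul_cancel_left₀ Real.pi_ne_zero, Real.sqrt_inv, ← div_eq_mul_inv,
        Real.div_sqrt]
    linear_combination (ρ * (exp (-(Real.pi * I * k ^ 2 / x)) / k)) * h4
  · refine DifferentiableOn.div (by fun_prop) differentiableOn_id ?_
    rintro z hz rfl
    simp at hz
    linarith [hz.1]
  · intro c' hcc u hu
    have h1 : 1 / Real.sqrt 2 ≤ ‖(c' + ρ * u : ℂ)‖ :=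
      (by gcongr : 1 / Real.sqrt 2 ≤ |u| / Real.sqrt 2).trans (norm_line_ge_im c' u)
    have h2 : |x * c' - k| ≤ x * c := by
      have h3 := (div_le_iff₀ hx).1 hcc.1
      have h4 := mul_le_mul_of_nonneg_left hcc.2 hx.le
      rw [abs_of_nonneg (by linarith)]
      linarith
    rw [norm_div, norm_exp_quadratic]
    calc _ ≤ Real.exp (Real.pi * (x * c) ^ 2 / x) * Real.exp (-(Real.pi * x / 2) * u ^ 2) /
          (1 / Real.sqrt 2) := by gcongr; exact exp_quadratic_le hx h2 u
      _ = _ := by field_simp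

theorem half_max_le_norm_one_add_exp (θ : ℝ) :
    1 / 2 * max 1 (Real.exp (-θ)) ≤ ‖1 + exp ((-θ : ℝ) + (θ : ℝ) * I)‖ := by
  set w := exp ((-θ : ℝ) + (θ : ℝ) * I) with hw
  have hn : ‖w‖ = Real.exp (-θ) := by rw [hw, norm_exp]; simp
  have hre : w.re = Real.exp (-θ) * Real.cos θ := by rw [hw, exp_re]; simp
  have hpi := Real.pi_gt_three
  rw [← hn]
  by_cases h : |θ| ≤ Real.pi / 2
  · have hre0 : 0 ≤ w.re := by
      rw [hre]
      exact mul_nonneg (Real.exp_pos _).le (Real.cos_nonneg_of_mem_Icc (abs_le.1 h))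
    have h1 : 1 ≤ ‖1 + w‖ := by
      have := re_le_norm (1 + w)
      rw [add_re, one_re] at this
      linarith
    have h2 : ‖w‖ ≤ ‖1 + w‖ := by
      refine (pow_le_pow_iff_left₀ (norm_nonneg _) (norm_nonneg _) two_ne_zero).1 ?_
      rw [← normSq_eq_norm_sq, ← normSq_eq_norm_sq, normSq_apply, normSq_apply, add_re, add_im,
        one_re, one_im]
      nlinarith
    have := max_le h1 h2
    have := norm_nonneg (1 + w)
    linarith
  · rcases lt_abs.1 (not_le.1 h) with h | h
    · have h2 := inv_anti₀ two_pos (two_le_exp (t := θ) (by linarith))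
      rw [← Real.exp_neg, ← hn] at h2
      have h3 := norm_sub_norm_le (1 : ℂ) (-w)
      rw [sub_neg_eq_add, norm_neg, norm_one] at h3
      rw [max_eq_left (by linarith)]
      linarith
    · have h2 := two_le_exp (t := -θ) (by linarith)
      rw [← hn] at h2
      have h3 := norm_sub_norm_le w (-1)
      rw [sub_neg_eq_add, norm_neg, norm_one, add_comm] at h3
      rw [max_eq_right (by linarith)]
      linarith

theorem half_max_le_norm_one_sub_exp (n : ℕ) (u : ℝ) :
    1 / 2 * max 1 (Real.exp (-(Real.sqrt 2 * Real.pi * u))) ≤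
      ‖1 - exp (2 * Real.pi * I * ((n + 1 / 2 : ℝ) + ρ * u))‖ := by
  convert half_max_le_norm_one_add_exp (Real.sqrt 2 * Real.pi * u) using 2
  rw [sub_eq_add_neg]
  congr 1
  have hs2 : (Real.sqrt 2 : ℂ) ^ 2 = 2 := by
    rw [← ofReal_pow, Real.sq_sqrt two_pos.le]; simp
  have hs0 : (Real.sqrt 2 : ℂ) ≠ 0 := by
    rw [ofReal_ne_zero]; positivity
  have e : (2 * Real.pi * I * ((n + 1 / 2 : ℝ) + ρ * u) : ℂ) =
      ((-(Real.sqrt 2 * Real.pi * u) : ℝ) + (Real.sqrt 2 * Real.pi * u : ℝ) * I) + Real.pi * I +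
        n * (2 * Real.pi * I) := by
    rw [rho_eq]
    push_cast
    field_simp
    linear_combination (u * (1 - I)) * hs2 + 2 * u * I_sq
  have h1 : exp (n * (2 * Real.pi * I)) = 1 := by simp
  rw [e, exp_add, exp_add, h1, exp_pi_mul_I]
  ring

theorem exp_neg_div_max_le {φ : ℝ} (h0 : 0 ≤ φ) (h1 : φ ≤ 1) (a t : ℝ) :
    Real.exp (-a - t * φ) / max 1 (Real.exp (-t)) ≤ Real.exp (-a) := by
  rw [div_le_iff₀ (lt_max_of_lt_left one_pos)]
  rcases le_total 0 t with h | h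
  · refine le_trans ?_ (le_mul_of_one_le_right (Real.exp_pos _).le (le_max_left _ _))
    rw [Real.exp_le_exp]
    nlinarith
  · refine le_trans ?_ (mul_le_mul_of_nonneg_left (le_max_right _ _) (Real.exp_pos _).le)
    rw [← Real.exp_add, Real.exp_le_exp]
    nlinarith

/-- Integrand of the remainder of the approximate functional equation. -/
noncomputable def afeRemainderKernel (x : ℝ) (m : ℕ) (z : ℂ) : ℂ :=
  exp (Real.pi * I * z ^ 2 * x - 2 * Real.pi * I * (m : ℝ) * z) / (z * (1 - exp (2 * Real.pi * I * z)))

theorem contourKernel_eq_sum (x : ℝ) {z : ℂ} (hz : 1 - exp (2 * Real.pi * I * z) ≠ 0) (m : ℕ) :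
    contourKernel x z = afeRemainderKernel x m z -
      ∑ k ∈ Finset.Icc 1 m, exp (Real.pi * I * z ^ 2 * x - 2 * Real.pi * I * (k : ℝ) * z) / z := by
  induction m with
  | zero => simp [contourKernel, afeRemainderKernel]
  | succ m ih =>
    rw [ih, Finset.sum_Icc_succ_top (by omega), ← sub_sub]
    have e : exp (Real.pi * I * z ^ 2 * x - 2 * Real.pi * I * (m : ℝ) * z) =
        exp (Real.pi * I * z ^ 2 * x - 2 * Real.pi * I * ((m + 1 : ℕ) : ℝ) * z) *
          exp (2 * Real.pi * I * z) := by
      rw [← exp_add]; congr 1; push_cast; ring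
    rw [afeRemainderKernel, afeRemainderKernel, e]
    rcases eq_or_ne z 0 with rfl | hz0
    · simp
    · generalize exp (2 * Real.pi * I * z) = w at hz ⊢
      generalize ∑ k ∈ Finset.Icc 1 m, (_ : ℂ) = S
      field_simp
      ring

theorem one_sub_exp_ne_zero (n : ℕ) (u : ℝ) :
    1 - exp (2 * Real.pi * I * ((n + 1 / 2 : ℝ) + ρ * u)) ≠ 0 :=
  norm_pos_iff.1 ((by positivity :
    0 < 1 / 2 * max 1 (Real.exp (-(Real.sqrt 2 * Real.pi * u)))).trans_le
      (half_max_le_norm_one_sub_exp n u))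

theorem line_ne_zero {c : ℝ} (hc : 0 < c) (u : ℝ) : (c + ρ * u : ℂ) ≠ 0 :=
  norm_pos_iff.1 ((by positivity : 0 < |c| / Real.sqrt 2).trans_le (norm_line_ge c u))

theorem norm_afeRemainderKernel_le {x : ℝ} {n m : ℕ} (h0 : m ≤ x * (n + 1 / 2))
    (h1 : x * (n + 1 / 2) ≤ m + 1) (u : ℝ) :
    ‖afeRemainderKernel x m ((n + 1 / 2 : ℝ) + ρ * u)‖ ≤
      2 * Real.sqrt 2 / (n + 1 / 2) * Real.exp (-(Real.pi * x) * u ^ 2) := by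
  have hs : 0 < Real.sqrt 2 := by positivity
  have hn : (0 : ℝ) < n + 1 / 2 := by positivity
  have h2 := norm_line_ge (n + 1 / 2) u
  rw [abs_of_pos hn] at h2
  rw [afeRemainderKernel, norm_div, norm_mul, norm_exp_quadratic]
  calc _ ≤ Real.exp (-(Real.pi * x * u ^ 2) - Real.sqrt 2 * Real.pi * u * (x * (n + 1 / 2) - m)) /
        ((n + 1 / 2) / Real.sqrt 2 * (1 / 2 * max 1 (Real.exp (-(Real.sqrt 2 * Real.pi * u))))) := by
        gcongr
        exact half_max_le_norm_one_sub_exp n u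
    _ = 2 * Real.sqrt 2 / (n + 1 / 2) *
        (Real.exp (-(Real.pi * x * u ^ 2) - Real.sqrt 2 * Real.pi * u * (x * (n + 1 / 2) - m)) /
          max 1 (Real.exp (-(Real.sqrt 2 * Real.pi * u)))) := by
        have : 0 < max 1 (Real.exp (-(Real.sqrt 2 * Real.pi * u))) := lt_max_of_lt_left one_pos
        field_simp
    _ ≤ _ := by
        rw [neg_mul]
        gcongr
        exact exp_neg_div_max_le (by linarith) (by linarith) _ _

theorem integrable_afeRemainderKernel {x : ℝ} (hx : 0 < x) {n m : ℕ} (h0 : m ≤ x * (n + 1 / 2))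
    (h1 : x * (n + 1 / 2) ≤ m + 1) :
    Integrable fun u : ℝ => afeRemainderKernel x m ((n + 1 / 2 : ℝ) + ρ * u) := by
  refine ((integrable_exp_neg_mul_sq (by positivity : 0 < Real.pi * x)).const_mul _).mono'
    (Continuous.aestronglyMeasurable ?_) (ae_of_all _ fun u => norm_afeRemainderKernel_le h0 h1 u)
  unfold afeRemainderKernel
  exact Continuous.div (by fun_prop) (by fun_prop) fun u =>
    mul_ne_zero (line_ne_zero (by positivity) u) (one_sub_exp_ne_zero n u)

theorem integrable_dualShift {x : ℝ} (hx : 0 < x) {c : ℝ} (hc : 0 < c) (k : ℝ) :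
    Integrable fun u : ℝ =>
      exp (Real.pi * I * (c + ρ * u) ^ 2 * x - 2 * Real.pi * I * k * (c + ρ * u)) / (c + ρ * u) := by
  refine integrable_of_norm_le_gaussian (K := Real.sqrt 2 * Real.exp (Real.pi * |x * c - k| ^ 2 / x))
    (A := Real.pi * x / 2) (Continuous.div (by fun_prop) (by fun_prop) (line_ne_zero hc))
    (by positivity) fun u hu => ?_
  have hs : 0 < Real.sqrt 2 := by positivity
  have h1 : 1 / Real.sqrt 2 ≤ ‖(c + ρ * u : ℂ)‖ :=
    (by gcongr : 1 / Real.sqrt 2 ≤ |u| / Real.sqrt 2).trans (norm_line_ge_im c u)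
  rw [norm_div, norm_exp_quadratic]
  calc _ ≤ Real.exp (Real.pi * |x * c - k| ^ 2 / x) * Real.exp (-(Real.pi * x / 2) * u ^ 2) /
        (1 / Real.sqrt 2) := by gcongr; exact exp_quadratic_le hx le_rfl u
    _ = _ := by field_simp

/-- The approximate functional equation for the partial sums of `F_1`. -/
theorem Fpart_sub_eq {x : ℝ} (hx : 0 < x) {n m : ℕ} (h0 : m ≤ x * (n + 1 / 2))
    (h1 : x * (n + 1 / 2) ≤ m + 1) :
    Fpart 1 n x 0 - ρ * Real.sqrt x * Fpart 1 m (-1 / x) 0 =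
      ρ * (∫ u : ℝ, contourKernel x ((1 / 2 : ℝ) + ρ * u)) + ∑ k ∈ Finset.Icc 1 m, dualTerm x k -
        ρ * ∫ u : ℝ, afeRemainderKernel x m ((n + 1 / 2 : ℝ) + ρ * u) := by
  have hn : (0 : ℝ) < n + 1 / 2 := by positivity
  rw [Fpart_eq_integral_sub hx]
  simp only [contourKernel_eq_sum x (one_sub_exp_ne_zero n _) m]
  rw [integral_sub (integrable_afeRemainderKernel hx h0 h1)
    (integrable_finsetSum _ fun (k : ℕ) _ => integrable_dualShift hx hn (k : ℝ)),
    integral_finsetSum _ fun (k : ℕ) _ => integrable_dualShift hx hn (k : ℝ), mul_sub, Finset.mul_sum]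
  have e : ∀ k ∈ Finset.Icc 1 m, ρ * ∫ u : ℝ, exp (Real.pi * I * ((n + 1 / 2 : ℝ) + ρ * u) ^ 2 * x -
      2 * Real.pi * I * (k : ℝ) * ((n + 1 / 2 : ℝ) + ρ * u)) / ((n + 1 / 2 : ℝ) + ρ * u) =
      dualTerm x k + ρ * Real.sqrt x * (exp (-(Real.pi * I * k ^ 2 / x)) / k) := by
    intro k hk
    rw [Finset.mem_Icc] at hk
    exact integral_dualShift hx hk.1 (le_trans (by exact_mod_cast hk.2) h0)
  rw [Finset.sum_congr rfl e, Finset.sum_add_distrib, ← Finset.mul_sum, Fpart_one_zero]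
  have e2 : ∀ k : ℕ, exp (Real.pi * I * k ^ 2 * ((-1 / x : ℝ) : ℂ)) = exp (-(Real.pi * I * k ^ 2 / x)) :=
    fun k => by congr 1; push_cast; ring
  simp only [e2]
  ring

theorem norm_afeRemainder_le {x : ℝ} (hx : 0 < x) {n m : ℕ} (h0 : m ≤ x * (n + 1 / 2))
    (h1 : x * (n + 1 / 2) ≤ m + 1) :
    ‖ρ * ∫ u : ℝ, afeRemainderKernel x m ((n + 1 / 2 : ℝ) + ρ * u)‖ ≤
      2 * Real.sqrt 2 / ((n + 1 / 2) * Real.sqrt x) := by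
  have hb : 0 < Real.pi * x := by positivity
  have hsx : 0 < Real.sqrt x := by positivity
  rw [norm_mul, norm_rho, one_mul]
  refine (norm_integral_le_of_norm_le ((integrable_exp_neg_mul_sq hb).const_mul _)
    (ae_of_all _ fun u => norm_afeRemainderKernel_le h0 h1 u)).trans_eq ?_
  rw [integral_const_mul, integral_gaussian, div_mul_cancel_left₀ Real.pi_ne_zero, Real.sqrt_inv]
  field_simp

/-- Difference between `F_{1,n}(x)` and its modular transform. -/
noncomputable def afeError (x : ℝ) (n : ℕ) : ℂ :=
  Fpart 1 n x 0 - ρ * Real.sqrt x * Fpart 1 ⌊x * (n + 1 / 2)⌋₊ (-1 / x) 0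

theorem afeError_eq {x : ℝ} (hx : 0 < x) (n : ℕ) :
    afeError x n =
      ρ * (∫ u : ℝ, contourKernel x ((1 / 2 : ℝ) + ρ * u)) +
        ∑ k ∈ Finset.Icc 1 ⌊x * (n + 1 / 2)⌋₊, dualTerm x k -
        ρ * ∫ u : ℝ, afeRemainderKernel x ⌊x * (n + 1 / 2)⌋₊ ((n + 1 / 2 : ℝ) + ρ * u) :=
  Fpart_sub_eq hx (Nat.floor_le (by positivity)) (Nat.lt_floor_add_one _).le

theorem norm_afeError_remainder_le {x : ℝ} (hx : 0 < x) (n : ℕ) :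
    ‖ρ * ∫ u : ℝ, afeRemainderKernel x ⌊x * (n + 1 / 2)⌋₊ ((n + 1 / 2 : ℝ) + ρ * u)‖ ≤
      2 * Real.sqrt 2 / ((n + 1 / 2) * Real.sqrt x) :=
  norm_afeRemainder_le hx (Nat.floor_le (by positivity)) (Nat.lt_floor_add_one _).le

theorem tendsto_mul_natCast_add_half {x : ℝ} (hx : 0 < x) :
    Tendsto (fun n : ℕ => x * ((n : ℝ) + 1 / 2)) atTop atTop :=
  (tendsto_atTop_add_const_right _ _ tendsto_natCast_atTop_atTop).const_mul_atTop hx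

theorem tendsto_afeError {x : ℝ} (hx : 0 < x) :
    Tendsto (afeError x) atTop (𝓝 (Ifun 1 x 0)) := by
  have h1 : Tendsto (fun m : ℕ => ∑ k ∈ Finset.Icc 1 m, dualTerm x k) atTop
      (𝓝 (Ifun 1 x 0 - ρ * ∫ u : ℝ, contourKernel x ((1 / 2 : ℝ) + ρ * u))) := by
    have e : ∀ m : ℕ, ∑ k ∈ Finset.Icc 1 m, dualTerm x k = ∑ k ∈ range m, dualTerm x (k + 1) := by
      intro m
      induction m with
      | zero => simp
      | succ m ih => rw [Finset.sum_Icc_succ_top (by omega), Finset.sum_range_succ, ih]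
    simp only [e]
    exact (hasSum_Ifun hx).tendsto_sum_nat
  have h2 := h1.comp ((tendsto_nat_floor_atTop (α := ℝ)).comp (tendsto_mul_natCast_add_half hx))
  have h3 : Tendsto (fun n : ℕ =>
      ρ * ∫ u : ℝ, afeRemainderKernel x ⌊x * (n + 1 / 2)⌋₊ ((n + 1 / 2 : ℝ) + ρ * u)) atTop (𝓝 0) := by
    refine squeeze_zero_norm (fun n => norm_afeError_remainder_le hx n) ?_
    refine tendsto_const_nhds.div_atTop ?_
    have := tendsto_mul_natCast_add_half (Real.sqrt_pos.2 hx)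
    simpa only [mul_comm] using this
  have h4 := (h2.const_add (ρ * ∫ u : ℝ, contourKernel x ((1 / 2 : ℝ) + ρ * u))).sub h3
  simp only [add_sub_cancel, sub_zero] at h4
  exact h4.congr fun n => (afeError_eq hx n).symm

theorem norm_Fpart_term (x : ℝ) (k : ℕ) : ‖exp (Real.pi * I * k ^ 2 * x) / k‖ = (k : ℝ)⁻¹ := by
  rw [norm_div, show (Real.pi * I * k ^ 2 * x : ℂ) = ((Real.pi * k ^ 2 * x : ℝ) : ℂ) * I by
    push_cast; ring, norm_exp_ofReal_mul_I, norm_natCast, one_div]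

theorem norm_Fpart_le_log (n : ℕ) (x : ℝ) : ‖Fpart 1 n x 0‖ ≤ 1 + Real.log n := by
  rw [Fpart_one_zero]
  refine (norm_sum_le _ _).trans ?_
  simp only [norm_Fpart_term]
  have h := harmonic_le_one_add_log n
  rw [harmonic_eq_sum_Icc] at h
  push_cast at h
  exact h

theorem norm_Fpart_le (n : ℕ) (x : ℝ) : ‖Fpart 1 n x 0‖ ≤ n := by
  rw [Fpart_one_zero]
  refine (norm_sum_le _ _).trans ?_
  simp only [norm_Fpart_term]
  refine (Finset.sum_le_card_nsmul _ _ 1 fun k hk => ?_).trans (by simp)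
  exact inv_le_one_of_one_le₀ (by exact_mod_cast (Finset.mem_Icc.1 hk).1)

theorem sum_inv_sq_le (m : ℕ) : ∑ k ∈ Finset.Icc 1 m, 1 / (k : ℝ) ^ 2 ≤ 2 := by
  suffices h : ∑ k ∈ Finset.Icc 1 m, 1 / (k : ℝ) ^ 2 ≤ 2 - 1 / ((m : ℝ) + 1 / 2) by
    have : 0 ≤ 1 / ((m : ℝ) + 1 / 2) := by positivity
    linarith
  induction m with
  | zero => norm_num
  | succ m ih =>
    rw [Finset.sum_Icc_succ_top (by omega)]
    have : 1 / ((m + 1 : ℕ) : ℝ) ^ 2 ≤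
        1 / ((m : ℝ) + 1 / 2) - 1 / (((m + 1 : ℕ) : ℝ) + 1 / 2) := by
      push_cast
      rw [div_sub_div _ _ (by positivity) (by positivity),
        div_le_div_iff₀ (by positivity) (by positivity)]
      nlinarith
    linarith

theorem norm_sum_dualTerm_le {x : ℝ} (hx : 0 < x) (m : ℕ) :
    ‖∑ k ∈ Finset.Icc 1 m, dualTerm x k‖ ≤ 2 * x := by
  refine (norm_sum_le_of_le _ fun k hk => norm_dualTerm_le hx (Finset.mem_Icc.1 hk).1).trans ?_
  rw [← Finset.mul_sum]
  nlinarith [sum_inv_sq_le m]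

theorem norm_afeError_le_of_le {x : ℝ} (hx : 0 < x) (hx1 : x ≤ 1) {n : ℕ} (hn : n ≤ 1 / x) :
    ‖afeError x n‖ ≤ 2 - Real.log x := by
  have hlog : Real.log x ≤ 0 := Real.log_nonpos hx.le hx1
  have h1 : ‖Fpart 1 n x 0‖ ≤ 1 - Real.log x := by
    rcases Nat.eq_zero_or_pos n with rfl | h0
    · rw [Fpart_one_zero]; simp; linarith
    · have := Real.log_le_log (by exact_mod_cast h0) hn
      rw [one_div, Real.log_inv] at this
      linarith [norm_Fpart_le_log n x]
  have h2 : ⌊x * (n + 1 / 2)⌋₊ ≤ 1 := by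
    have h3 : x * n ≤ 1 := by rwa [le_div_iff₀ hx, mul_comm] at hn
    refine Nat.lt_succ_iff.1 ((Nat.floor_lt (by positivity)).2 ?_)
    push_cast
    linarith
  have h4 : ‖ρ * Real.sqrt x * Fpart 1 ⌊x * (n + 1 / 2)⌋₊ (-1 / x) 0‖ ≤ 1 * 1 * 1 := by
    rw [norm_mul, norm_mul, norm_rho, norm_real, Real.norm_of_nonneg (Real.sqrt_nonneg x)]
    gcongr
    · exact Real.sqrt_le_one.2 hx1
    · exact (norm_Fpart_le _ _).trans (by exact_mod_cast h2)
  refine (norm_sub_le _ _).trans ?_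
  linarith

theorem norm_afeError_le {x : ℝ} (hx : 0 < x) (hx1 : x ≤ 1) (n : ℕ) :
    ‖afeError x n‖ ≤ 18 - Real.log x := by
  rcases le_or_gt (n : ℝ) (1 / x) with hn | hn
  · linarith [norm_afeError_le_of_le hx hx1 hn]
  · set n₀ := ⌊1 / x⌋₊ with hn₀
    have h1x : 1 ≤ 1 / x := (one_le_div hx).2 hx1
    have hle : (n₀ : ℝ) ≤ 1 / x := Nat.floor_le (by positivity)
    have h1 : (1 : ℝ) ≤ n₀ := by
      exact_mod_cast (Nat.one_le_floor_iff _).2 h1x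
    have h2 : 1 / x < n₀ + 1 := Nat.lt_floor_add_one _
    have hs2 : Real.sqrt 2 ≤ 3 / 2 := Real.sqrt_le_iff.2 ⟨by norm_num, by norm_num⟩
    have hsx : 0 < Real.sqrt x := by positivity
    have hsx1 : Real.sqrt x ≤ 1 := Real.sqrt_le_one.2 hx1
    have hR : ∀ k : ℕ, (n₀ : ℝ) ≤ k →
        2 * Real.sqrt 2 / (((k : ℝ) + 1 / 2) * Real.sqrt x) ≤ 6 := by
      intro k hk
      have h3 : 1 / (2 * x) ≤ k + 1 / 2 := by
        rw [show 1 / (2 * x) = (1 / x) / 2 by field_simp]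
        linarith
      calc 2 * Real.sqrt 2 / (((k : ℝ) + 1 / 2) * Real.sqrt x) ≤
          2 * (3 / 2) / (1 / (2 * x) * Real.sqrt x) := by gcongr
        _ = 6 * Real.sqrt x := by
          nth_rewrite 1 [← Real.mul_self_sqrt hx.le]
          field_simp
          norm_num
        _ ≤ 6 := by linarith
    have h4 := norm_afeError_le_of_le hx hx1 hle
    have h5 := (norm_afeError_remainder_le hx n).trans (hR n (hle.trans hn.le))
    have h6 := (norm_afeError_remainder_le hx n₀).trans (hR n₀ le_rfl)
    have h7 := norm_sum_dualTerm_le hx ⌊x * (n + 1 / 2)⌋₊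
    have h8 := norm_sum_dualTerm_le hx ⌊x * (n₀ + 1 / 2)⌋₊
    have e : afeError x n = afeError x n₀ +
        (∑ k ∈ Finset.Icc 1 ⌊x * (n + 1 / 2)⌋₊, dualTerm x k -
          ∑ k ∈ Finset.Icc 1 ⌊x * (n₀ + 1 / 2)⌋₊, dualTerm x k) -
        (ρ * (∫ u : ℝ, afeRemainderKernel x ⌊x * (n + 1 / 2)⌋₊ ((n + 1 / 2 : ℝ) + ρ * u)) -
          ρ * ∫ u : ℝ, afeRemainderKernel x ⌊x * (n₀ + 1 / 2)⌋₊ ((n₀ + 1 / 2 : ℝ) + ρ * u)) := by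
      rw [afeError_eq hx, afeError_eq hx]
      ring
    rw [e]
    refine (norm_sub_le _ _).trans ((add_le_add (norm_add_le _ _) (norm_sub_le _ _)).trans ?_)
    have h9 := norm_sub_le (∑ k ∈ Finset.Icc 1 ⌊x * (n + 1 / 2)⌋₊, dualTerm x k)
      (∑ k ∈ Finset.Icc 1 ⌊x * (n₀ + 1 / 2)⌋₊, dualTerm x k)
    linarith

theorem conj_Fpart (n : ℕ) (x : ℝ) : (starRingEnd ℂ) (Fpart 1 n x 0) = Fpart 1 n (-x) 0 := by
  rw [Fpart_one_zero, Fpart_one_zero, map_sum]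
  refine Finset.sum_congr rfl fun k _ => ?_
  rw [map_div₀, ← exp_conj]
  simp

theorem Fpart_Tmap (n : ℕ) (x : ℝ) : Fpart 1 n (Tmap x) 0 = Fpart 1 n (-1 / x) 0 := by
  rw [Fpart_one_zero, Fpart_one_zero]
  refine Finset.sum_congr rfl fun k _ => ?_
  congr 1
  rw [Tmap]
  generalize ⌈((-1 / x) - 1) / 2⌉ = m
  rw [exp_eq_exp_iff_exists_int]
  refine ⟨-((k : ℤ) ^ 2 * m), ?_⟩
  push_cast
  ring

/-- The multiplier of the modular transformation at `x`. -/
noncomputable def multiplier (x : ℝ) : ℂ :=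
  exp (Real.pi * I / 4 * (Real.sign x : ℝ)) * (Real.sqrt |x| : ℝ)

theorem norm_exp_pi_div_four_mul (a : ℝ) : ‖exp (Real.pi * I / 4 * a)‖ = 1 := by
  rw [show (Real.pi * I / 4 * a : ℂ) = ((Real.pi / 4 * a : ℝ) : ℂ) * I by push_cast; ring,
    norm_exp_ofReal_mul_I]

noncomputable def signedError (x : ℝ) (n : ℕ) : ℂ :=
  Fpart 1 n x 0 - multiplier x * Fpart 1 ⌊|x| * (n + 1 / 2)⌋₊ (Tmap x) 0

theorem signedError_of_pos {x : ℝ} (hx : 0 < x) (n : ℕ) : signedError x n = afeError x n := by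
  rw [signedError, afeError, multiplier, Real.sign_of_pos hx, abs_of_pos hx, Fpart_Tmap, ρ]
  simp

theorem signedError_of_neg {x : ℝ} (hx : x < 0) (n : ℕ) :
    signedError x n = (starRingEnd ℂ) (afeError (-x) n) := by
  have hρ : (starRingEnd ℂ) ρ = exp (Real.pi * I / 4 * (-1 : ℝ)) := by
    rw [ρ, ← exp_conj]
    simp [neg_div, map_ofNat]
  rw [signedError, afeError, multiplier, Real.sign_of_neg hx, abs_of_neg hx, Fpart_Tmap, map_sub,
    map_mul, map_mul, conj_Fpart, conj_Fpart, conj_ofReal, hρ, neg_div_neg_eq, neg_neg,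
    neg_div]

theorem tendsto_signedError {x : ℝ} (hx : x ≠ 0) :
    Tendsto (signedError x) atTop (𝓝 (Omega0 1 x)) := by
  rcases hx.lt_or_gt with h | h
  · rw [Omega0, Omega, if_neg h.not_gt, neg_zero]
    exact ((continuous_conj.tendsto _).comp (tendsto_afeError (neg_pos.2 h))).congr
      fun n => (signedError_of_neg h n).symm
  · rw [Omega0, Omega, if_pos h]
    exact (tendsto_afeError h).congr fun n => (signedError_of_pos h n).symm

theorem norm_signedError_le {x : ℝ} (hx : x ≠ 0) (hx1 : |x| ≤ 1) (n : ℕ) :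
    ‖signedError x n‖ ≤ 18 - Real.log |x| := by
  rcases hx.lt_or_gt with h | h
  · rw [abs_of_neg h] at hx1 ⊢
    rw [signedError_of_neg h, RCLike.norm_conj]
    exact norm_afeError_le (neg_pos.2 h) hx1 n
  · rw [abs_of_pos h] at hx1 ⊢
    rw [signedError_of_pos h]
    exact norm_afeError_le h hx1 n

/-- Lengths of the successive partial sums when the modular transformation is iterated. -/
noncomputable def cutoff (x : ℝ) (n : ℕ) : ℕ → ℕ
  | 0 => n
  | j + 1 => ⌊|Tmap^[j] x| * (cutoff x n j + 1 / 2)⌋₊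

theorem cutoff_le {x : ℝ} (h : ∀ j, |Tmap^[j] x| < 1) (n j : ℕ) : cutoff x n j ≤ n := by
  induction j with
  | zero => exact le_rfl
  | succ j ih =>
    refine le_trans (Nat.lt_succ_iff.1 ((Nat.floor_lt (by positivity)).2 ?_)) ih
    have h1 : (0 : ℝ) ≤ cutoff x n j := by positivity
    push_cast
    nlinarith [h j]

theorem tendsto_cutoff {x : ℝ} (h : ∀ j, Tmap^[j] x ≠ 0) (j : ℕ) :
    Tendsto (fun n => cutoff x n j) atTop atTop := by
  induction j with
  | zero => exact tendsto_id
  | succ j ih =>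
    exact ((tendsto_nat_floor_atTop (α := ℝ)).comp
      (tendsto_mul_natCast_add_half (abs_pos.2 (h j)))).comp ih

/-- The coefficient of the `j`-th term of the expansion of `F_1(x)`. -/
noncomputable def expansionCoeff (x : ℝ) (j : ℕ) : ℂ :=
  exp (Real.pi * I / 4 * ((∑ ℓ ∈ range j, Real.sign (Tmap^[ℓ] x) : ℝ) : ℂ)) *
    ((Real.sqrt (∏ ℓ ∈ range j, |Tmap^[ℓ] x|) : ℝ) : ℂ)

theorem expansionCoeff_succ (x : ℝ) (j : ℕ) :
    expansionCoeff x (j + 1) = expansionCoeff x j * multiplier (Tmap^[j] x) := by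
  rw [expansionCoeff, expansionCoeff, multiplier, Finset.sum_range_succ, Finset.prod_range_succ,
    Real.sqrt_mul (Finset.prod_nonneg fun _ _ => abs_nonneg _), ofReal_add, mul_add, exp_add,
    ofReal_mul]
  ring

theorem norm_expansionCoeff (x : ℝ) (j : ℕ) :
    ‖expansionCoeff x j‖ = Real.sqrt (∏ ℓ ∈ range j, |Tmap^[ℓ] x|) := by
  rw [expansionCoeff, norm_mul, norm_exp_pi_div_four_mul, one_mul, norm_real,
    Real.norm_of_nonneg (Real.sqrt_nonneg _)]

theorem Fpart_eq_sum_signedError (x : ℝ) (n J : ℕ) :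
    Fpart 1 n x 0 =
      ∑ j ∈ range J, expansionCoeff x j * signedError (Tmap^[j] x) (cutoff x n j) +
        expansionCoeff x J * Fpart 1 (cutoff x n J) (Tmap^[J] x) 0 := by
  induction J with
  | zero => simp [expansionCoeff, cutoff]
  | succ J ih =>
    rw [ih, Finset.sum_range_succ, expansionCoeff_succ, Function.iterate_succ_apply', cutoff,
      signedError]
    ring

theorem hasSum_signedError {x : ℝ} (h : ∀ j, |Tmap^[j] x| < 1)
    (hs : Summable fun j => Real.sqrt (∏ l ∈ range j, |Tmap^[l] x|)) {n : ℕ}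
    (hsum : Summable fun j => expansionCoeff x j * signedError (Tmap^[j] x) (cutoff x n j)) :
    ∑' j, expansionCoeff x j * signedError (Tmap^[j] x) (cutoff x n j) = Fpart 1 n x 0 := by
  have h1 : Tendsto (fun J => expansionCoeff x J * Fpart 1 (cutoff x n J) (Tmap^[J] x) 0) atTop
      (𝓝 0) := by
    refine squeeze_zero_norm (a := fun J => Real.sqrt (∏ l ∈ range J, |Tmap^[l] x|) * n)
      (fun J => ?_) (by simpa using hs.tendsto_atTop_zero.mul_const (n : ℝ))
    rw [norm_mul, norm_expansionCoeff]
    gcongr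
    exact (norm_Fpart_le _ _).trans (by exact_mod_cast cutoff_le h n J)
  have h2 := hsum.hasSum.tendsto_sum_nat.add h1
  rw [add_zero] at h2
  refine tendsto_nhds_unique h2 (tendsto_const_nhds.congr fun J => Fpart_eq_sum_signedError x n J)

theorem exists_tendsto_Fpart {x : ℝ} (hx : Irrational x) (hx1 : |x| < 1)
    (hs : Summable fun j => Real.sqrt (∏ l ∈ range j, |Tmap^[l] x|))
    (hlog : Summable fun j =>
      Real.sqrt (∏ l ∈ range j, |Tmap^[l] x|) * -Real.log |Tmap^[j] x|) :
    ∃ L : ℂ, Tendsto (fun n : ℕ => Fpart 1 n x 0) atTop (𝓝 L) ∧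
      HasSum (fun j : ℕ => expansionCoeff x j * Omega0 1 (Tmap^[j] x)) L := by
  have h1 := abs_iterate_Tmap_lt_one hx hx1
  have h0 : ∀ j, Tmap^[j] x ≠ 0 := fun j => (irrational_iterate_Tmap hx j).ne_zero
  set B : ℕ → ℝ := fun j => Real.sqrt (∏ l ∈ range j, |Tmap^[l] x|) * (18 - Real.log |Tmap^[j] x|)
    with hB
  have hBs : Summable B := by
    refine ((hs.mul_right 18).add hlog).congr fun j => ?_
    rw [hB]; ring
  have hbound : ∀ n j, ‖expansionCoeff x j * signedError (Tmap^[j] x) (cutoff x n j)‖ ≤ B j := by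
    intro n j
    rw [norm_mul, norm_expansionCoeff]
    exact mul_le_mul_of_nonneg_left (norm_signedError_le (h0 j) (h1 j).le _) (Real.sqrt_nonneg _)
  have hlim : ∀ j, Tendsto (fun n => expansionCoeff x j * signedError (Tmap^[j] x) (cutoff x n j))
      atTop (𝓝 (expansionCoeff x j * Omega0 1 (Tmap^[j] x))) := fun j =>
    ((tendsto_signedError (h0 j)).comp (tendsto_cutoff h0 j)).const_mul _
  have hsum : Summable fun j : ℕ => expansionCoeff x j * Omega0 1 (Tmap^[j] x) :=
    Summable.of_norm_bounded hBs fun j =>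
      le_of_tendsto (hlim j).norm (Eventually.of_forall fun n => hbound n j)
  refine ⟨_, ?_, hsum.hasSum⟩
  refine (tendsto_tsum_of_dominated_convergence hBs hlim
    (Eventually.of_forall fun n j => hbound n j)).congr fun n => ?_
  exact hasSum_signedError h1 hs (Summable.of_norm_bounded hBs (hbound n))

/-- identity for `F_1(x)` under the logarithmic summability condition, and this
condition holds whenever `μ(x) < 5/2`. -/
theorem stmt16 (x : ℝ) (hx : x ∈ Set.Ioo (0 : ℝ) 1) (hirr : Irrational x) :
    (Summable (fun n : ℕ =>
        Real.log (Qden x (n + 2)) / Real.sqrt (Qden x n)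
          + Qden x (n + 2) * Real.log (Qden x (n + 2)) ^ 2 / Qden x (n + 1) ^ ((3 : ℝ) / 2)) →
      ∃ L : ℂ, Tendsto (fun n : ℕ => Fpart 1 n x 0) atTop (𝓝 L) ∧
        HasSum (fun j : ℕ =>
          Complex.exp (Real.pi * Complex.I / 4
              * ((∑ ℓ ∈ Finset.range j, Real.sign (Tmap^[ℓ] x) : ℝ) : ℂ))
            * ((Real.sqrt (∏ ℓ ∈ Finset.range j, |Tmap^[ℓ] x|) : ℝ) : ℂ)
            * Omega0 1 (Tmap^[j] x)) L) ∧
    (irrExp x < (((5 : ℝ) / 2 : ℝ) : EReal) →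
      Summable (fun n : ℕ =>
        Real.log (Qden x (n + 2)) / Real.sqrt (Qden x n)
          + Qden x (n + 2) * Real.log (Qden x (n + 2)) ^ 2 / Qden x (n + 1) ^ ((3 : ℝ) / 2))) := by
  have hx1 : |x| < 1 := abs_lt.2 ⟨by linarith [hx.1], hx.2⟩
  refine ⟨fun h => ?_, summable_of_irrExp_lt hirr⟩
  have h2 : Summable fun n : ℕ =>
      Qden x (n + 2) * Real.log (Qden x (n + 2)) ^ 2 / Qden x (n + 1) ^ ((3 : ℝ) / 2) := by
    have hlog : ∀ n, 0 ≤ Real.log (Qden x n) := fun n => Real.log_nonneg (one_le_Qden hirr n)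
    have hpos : ∀ n, 0 ≤ Qden x n := fun n => zero_le_one.trans (one_le_Qden hirr n)
    refine Summable.of_nonneg_of_le (fun n => ?_) (fun n => ?_) h
    · exact div_nonneg (mul_nonneg (hpos _) (sq_nonneg _)) (Real.rpow_nonneg (hpos _) _)
    · exact le_add_of_nonneg_left (div_nonneg (hlog _) (Real.sqrt_nonneg _))
  obtain ⟨hs, hl⟩ := summable_sqrt_prod_iterate hirr hx1 ((summable_nat_add_iff 1).1 h2)
  exact exists_tendsto_Fpart hirr hx1 hs hl
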